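/- Assume p < n/s. Let μ ∈ C_0^∞(ℝⁿ) be nonnegative, g ∈ W^{s,p}(ℝⁿ), and let u ∈ W^{s,p}(ℝⁿ) be a weak solution of −L_Φ u = μ in Ω with u = g on ℝⁿ∖Ω, such that u ≥ 0 a.e. in a ball B_{4r}(x₀) ⊂ Ω. Then there exists a constant c depending only on n, s, p, Λ such that μ(B_r(x₀)) / r^{n−sp} ≤ c [ inf_{B_r(x₀)} u + Tail(u₋; x₀, 4r) ]^{p−1}, where u₋ := max{−u, 0} and the infimum is the essential infimum. -/

import Mathlib

noncomputable section

open MeasureTheory Metric Set Filter Topology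
open scoped ENNReal NNReal

/-- Euclidean space `ℝⁿ`. -/
abbrev Rn (n : ℕ) : Type := EuclideanSpace ℝ (Fin n)

/-- `q_* = max {1, p-1}`. -/
def qStar (p : ℝ) : ℝ := max 1 (p - 1)

/-- `q̄ = min {n(p-1)/(n-s), p}`. -/
def qBar (n : ℕ) (s p : ℝ) : ℝ := min ((n : ℝ) * (p - 1) / ((n : ℝ) - s)) p

/-- Gagliardo seminorm raised to the power `p`, as an `ℝ≥0∞`-valued double integral. -/
def gagliardo (n : ℕ) (s p : ℝ) (O : Set (Rn n)) (v : Rn n → ℝ) : ℝ≥0∞ :=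
  ∫⁻ x in O, ∫⁻ y in O, ENNReal.ofReal (|v x - v y| ^ p / ‖x - y‖ ^ ((n : ℝ) + s * p))

/-- `v ∈ W^{s,p}(O)`. -/
def memWsp (n : ℕ) (s p : ℝ) (O : Set (Rn n)) (v : Rn n → ℝ) : Prop :=
  AEMeasurable v (volume.restrict O) ∧
    (∫⁻ x in O, ENNReal.ofReal (|v x| ^ p)) < ⊤ ∧ gagliardo n s p O v < ⊤

/-- `Tail(v; x₀, r)`. -/
def tailFn (n : ℕ) (s p : ℝ) (v : Rn n → ℝ) (x₀ : Rn n) (r : ℝ) : ℝ≥0∞ :=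
  (ENNReal.ofReal (r ^ (s * p)) *
      ∫⁻ x in (ball x₀ r)ᶜ,
        ENNReal.ofReal (|v x| ^ (p - 1) / ‖x - x₀‖ ^ ((n : ℝ) + s * p))) ^ (1 / (p - 1))

/-- `v ∈ L^{p-1}_{sp}(ℝⁿ)`. -/
def memTailSpace (n : ℕ) (s p : ℝ) (v : Rn n → ℝ) : Prop :=
  AEMeasurable v (volume : Measure (Rn n)) ∧
    (∀ R : ℝ, (∫⁻ x in ball (0 : Rn n) R, ENNReal.ofReal (|v x| ^ (p - 1))) < ⊤) ∧
    ∀ z : Rn n, ∀ r : ℝ, 0 < r → tailFn n s p v z r < ⊤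

/-- `φ ∈ C_0^∞(O)`. -/
def IsTestFun (n : ℕ) (O : Set (Rn n)) (φ : Rn n → ℝ) : Prop :=
  ContDiff ℝ (⊤ : ℕ∞) φ ∧ HasCompactSupport φ ∧ tsupport φ ⊆ O

/-- The nonlocal form `⟨-L_Φ u, φ⟩`. -/
def nonlocalForm (n : ℕ) (Φ : ℝ → ℝ) (K : Rn n → Rn n → ℝ) (u φ : Rn n → ℝ) : ℝ :=
  ∫ x : Rn n, ∫ y : Rn n, Φ (u x - u y) * (φ x - φ y) * K x y

/-- Ellipticity/coercivity bounds on the kernel `K`. -/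
def KernelBounds (n : ℕ) (Λ s p : ℝ) (K : Rn n → Rn n → ℝ) : Prop :=
  Measurable (Function.uncurry K) ∧
    ∀ x y : Rn n, x ≠ y →
      1 / (Λ * ‖x - y‖ ^ ((n : ℝ) + s * p)) ≤ K x y ∧
        K x y ≤ Λ / ‖x - y‖ ^ ((n : ℝ) + s * p)

/-- Structure conditions on `Φ`. -/
def PhiBounds (Λ p : ℝ) (Φ : ℝ → ℝ) : Prop :=
  Continuous Φ ∧ Φ 0 = 0 ∧
    ∀ t : ℝ, |t| ^ p / Λ ≤ Φ t * t ∧ Φ t * t ≤ Λ * |t| ^ p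

/-- `∫ φ dμ` for a signed measure `μ`. -/
def sintegral (n : ℕ) (μ : MeasureTheory.SignedMeasure (Rn n)) (φ : Rn n → ℝ) : ℝ :=
  (∫ x, φ x ∂μ.toJordanDecomposition.posPart) -
    ∫ x, φ x ∂μ.toJordanDecomposition.negPart

/-- Weak (energy) solution of `-L_Φ u = f` in `Ω`, `u = g` on `ℝⁿ ∖ Ω`. -/
def WeakSol (n : ℕ) (Φ : ℝ → ℝ) (K : Rn n → Rn n → ℝ) (s p : ℝ)
    (Ω : Set (Rn n)) (f g u : Rn n → ℝ) : Prop :=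
  memWsp n s p univ u ∧ (∀ᵐ x : Rn n, x ∉ Ω → u x = g x) ∧
    ∀ φ : Rn n → ℝ, IsTestFun n Ω φ → nonlocalForm n Φ K u φ = ∫ x : Rn n, φ x * f x

/-- Weak subsolution of the homogeneous equation `-L_Φ w = 0` in `Ω`. -/
def WeakSubSol (n : ℕ) (Φ : ℝ → ℝ) (K : Rn n → Rn n → ℝ) (s p : ℝ)
    (Ω : Set (Rn n)) (w : Rn n → ℝ) : Prop :=
  memWsp n s p univ w ∧
    ∀ φ : Rn n → ℝ, IsTestFun n Ω φ → (∀ x, 0 ≤ φ x) → nonlocalForm n Φ K w φ ≤ 0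

/-- The approximation properties required of a SOLA. -/
def SOLAApprox (n : ℕ) (Φ : ℝ → ℝ) (K : Rn n → Rn n → ℝ) (s p : ℝ)
    (Ω : Set (Rn n)) (μ : MeasureTheory.SignedMeasure (Rn n)) (g u : Rn n → ℝ)
    (uj μj gj : ℕ → Rn n → ℝ) : Prop :=
  (∀ j, ContDiff ℝ (⊤ : ℕ∞) (μj j) ∧ HasCompactSupport (μj j)) ∧
  (∀ j, ContDiff ℝ (⊤ : ℕ∞) (gj j) ∧ HasCompactSupport (gj j)) ∧
  (∀ j, WeakSol n Φ K s p Ω (μj j) (gj j) (uj j)) ∧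
  (∀ᵐ x : Rn n, Tendsto (fun j => uj j x) atTop (𝓝 (u x))) ∧
  (∀ q : ℝ, qStar p ≤ q → q < qBar n s p → ∀ z : Rn n, ∀ r : ℝ, 0 < r →
    Tendsto (fun j => ∫⁻ x in ball z r, ENNReal.ofReal (|uj j x - u x| ^ q)) atTop (𝓝 0)) ∧
  (∀ φ : Rn n → ℝ, Continuous φ → HasCompactSupport φ → tsupport φ ⊆ Ω →
    Tendsto (fun j => ∫ x : Rn n, φ x * μj j x) atTop (𝓝 (sintegral n μ φ))) ∧
  (∀ z : Rn n, ∀ r : ℝ, 0 < r →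
    Filter.limsup (fun j => ∫⁻ x in ball z r, ENNReal.ofReal |μj j x|) atTop
      ≤ μ.totalVariation (closedBall z r)) ∧
  (∀ z : Rn n, ∀ r : ℝ, 0 < r →
    Tendsto (fun j =>
        (∫⁻ x in ball z r, ENNReal.ofReal (|gj j x - g x| ^ p)) +
          gagliardo n s p (ball z r) (fun x => gj j x - g x)) atTop (𝓝 0) ∧
      Tendsto (fun j => tailFn n s p (fun x => gj j x - g x) z r) atTop (𝓝 0))

/-- SOLA of the Dirichlet problem `-L_Φ u = μ` in `Ω`, `u = g` on `ℝⁿ ∖ Ω`. -/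
def IsSOLA (n : ℕ) (Φ : ℝ → ℝ) (K : Rn n → Rn n → ℝ) (s p : ℝ)
    (Ω : Set (Rn n)) (μ : MeasureTheory.SignedMeasure (Rn n)) (g u : Rn n → ℝ) : Prop :=
  (∀ h q : ℝ, 0 < h → h < s → qStar p ≤ q → q < qBar n s p → memWsp n h q Ω u) ∧
  (∀ φ : Rn n → ℝ, IsTestFun n Ω φ → nonlocalForm n Φ K u φ = sintegral n μ φ) ∧
  (∀ᵐ x : Rn n, x ∉ Ω → u x = g x) ∧
  ∃ uj μj gj : ℕ → Rn n → ℝ, SOLAApprox n Φ K s p Ω μ g u uj μj gj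

/-- Truncated Wolff potential `W^ν_{s,p}(x₀, r)`. -/
def wolff (n : ℕ) (s p : ℝ) (ν : Measure (Rn n)) (x₀ : Rn n) (r : ℝ) : ℝ≥0∞ :=
  ∫⁻ ρ in Ioc (0 : ℝ) r,
    (ν (ball x₀ ρ) / ENNReal.ofReal (ρ ^ ((n : ℝ) - s * p))) ^ (1 / (p - 1)) /
      ENNReal.ofReal ρ

/-- Integral average of `u` over `B_r(x₀)`. -/
def ballAvg (n : ℕ) (u : Rn n → ℝ) (x₀ : Rn n) (r : ℝ) : ℝ :=
  ⨍ x in ball x₀ r, u x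

/-- Local excess `A(f; x₀, r)`. -/
def locExcess (n : ℕ) (p : ℝ) (f : Rn n → ℝ) (x₀ : Rn n) (r : ℝ) : ℝ≥0∞ :=
  ((volume (ball x₀ r))⁻¹ *
      ∫⁻ x in ball x₀ r, ENNReal.ofReal (|f x - ballAvg n f x₀ r| ^ qStar p)) ^ (1 / qStar p)

/-- Global excess `E(f; x₀, r)`. -/
def excess (n : ℕ) (s p : ℝ) (f : Rn n → ℝ) (x₀ : Rn n) (r : ℝ) : ℝ≥0∞ :=
  locExcess n p f x₀ r + tailFn n s p (fun x => f x - ballAvg n f x₀ r) x₀ r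

/-- `g ∈ W^{s,p}_loc(ℝⁿ) ∩ L^{p-1}_{sp}(ℝⁿ)`. -/
def BoundaryDatum (n : ℕ) (s p : ℝ) (g : Rn n → ℝ) : Prop :=
  (∀ z : Rn n, ∀ r : ℝ, 0 < r → memWsp n s p (ball z r) g) ∧ memTailSpace n s p g

/-- Symmetric measurable kernel with ellipticity bounds. -/
def SymKernel (n : ℕ) (Λ s p : ℝ) (Kt : Rn n → Rn n → ℝ) : Prop :=
  KernelBounds n Λ s p Kt ∧ ∀ x y : Rn n, Kt x y = Kt y x

/-- Weak solution of the kernel-`Kt` fractional `p`-Laplace equation with datum `f` in `O`. -/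
def WeakSolP (n : ℕ) (Kt : Rn n → Rn n → ℝ) (s p : ℝ) (O : Set (Rn n))
    (f u : Rn n → ℝ) : Prop :=
  memWsp n s p univ u ∧
    ∀ φ : Rn n → ℝ, IsTestFun n O φ →
      (∫ x : Rn n, ∫ y : Rn n,
          |u x - u y| ^ (p - 2) * (u x - u y) * (φ x - φ y) * Kt x y) =
        ∫ x : Rn n, φ x * f x

/-- The part of the nonlocal energy of `u` against `φ` coming from the pairs `(x, y)` at which both
`u` and `φ` decrease from `x` to `y`. -/
def alignedEnergy (n : ℕ) (s p : ℝ) (u φ : Rn n → ℝ) : ℝ≥0∞ :=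
  ∫⁻ x, ∫⁻ y, ENNReal.ofReal
    ((max (u x - u y) 0) ^ (p - 1) * max (φ x - φ y) 0 / ‖x - y‖ ^ ((n : ℝ) + s * p))

/-- The truncated kernel `min {1, |z|^p} |z|^{-n-sp}` is integrable, uniformly in the centre. -/
lemma exists_lintegral_truncatedKernel_le {n : ℕ} {s p : ℝ} (hn : 1 ≤ n) (hs : 0 < s) (hs1 : s < 1)
    (hp : 0 < p) :
    ∃ C : ℝ≥0, ∀ x : Rn n,
      ∫⁻ y, ENNReal.ofReal (min 1 (‖x - y‖ ^ p) / ‖x - y‖ ^ ((n : ℝ) + s * p)) ≤ C := by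
  set f : Rn n → ℝ := fun z => min 1 (‖z‖ ^ p) / ‖z‖ ^ ((n : ℝ) + s * p) with hf
  have hsp : 0 < s * p := by positivity
  have hfm : Measurable f := by fun_prop
  have hf0 : ∀ z, 0 ≤ f z := fun z => by positivity
  have hball : IntegrableOn f (ball 0 1) := by
    refine integrableOn_ball_of_norm_le_rpow (C := 1) (α := n + s * p - p) ?_ ?_ ?_ ?_
    · simpa using hn
    · simp only [finrank_euclideanSpace, Fintype.card_fin]; nlinarith
    · refine ae_of_all _ fun z => ?_
      rcases eq_or_ne z 0 with rfl | hz
      · have h1 : (0 : ℝ) < n + s * p := by positivity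
        simp only [hf, norm_zero, Real.zero_rpow h1.ne', div_zero]
        positivity
      · have hz' : 0 < ‖z‖ := norm_pos_iff.2 hz
        rw [Real.norm_of_nonneg (hf0 z), one_mul, neg_sub, Real.rpow_sub hz']
        exact div_le_div_of_nonneg_right (min_le_right _ _) (by positivity)
    · exact hfm.aestronglyMeasurable
  have hcompl : IntegrableOn f (ball 0 1)ᶜ := by
    have h1 : Integrable (fun z : Rn n =>
        2 ^ ((n : ℝ) + s * p) * (1 + ‖z‖) ^ (-((n : ℝ) + s * p))) := by
      refine (integrable_one_add_norm ?_).const_mul _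
      simp only [finrank_euclideanSpace, Fintype.card_fin]; linarith
    refine h1.integrableOn.mono' hfm.aestronglyMeasurable ?_
    refine (ae_restrict_iff' measurableSet_ball.compl).2 (ae_of_all _ fun z hz => ?_)
    have hz1 : 1 ≤ ‖z‖ := by simpa using hz
    rw [Real.norm_of_nonneg (hf0 z), Real.rpow_neg (by positivity), ← div_eq_mul_inv,
      ← Real.div_rpow (by positivity) (by positivity)]
    have h2 : f z ≤ 1 / ‖z‖ ^ ((n : ℝ) + s * p) :=
      div_le_div_of_nonneg_right (min_le_left _ _) (by positivity)
    refine h2.trans ?_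
    have h3 : 1 / ‖z‖ ^ ((n : ℝ) + s * p) = (1 / ‖z‖) ^ ((n : ℝ) + s * p) := by
      rw [Real.div_rpow zero_le_one (by positivity), Real.one_rpow]
    rw [h3]
    refine Real.rpow_le_rpow (by positivity) ?_ (by positivity)
    rw [div_le_div_iff₀ (by positivity) (by positivity)]
    linarith
  have hi_int : Integrable f := by
    rw [← integrableOn_univ, ← union_compl_self (ball (0 : Rn n) 1)]
    exact hball.union hcompl
  refine ⟨(∫⁻ z, ENNReal.ofReal (f z)).toNNReal, fun x => ?_⟩
  rw [ENNReal.coe_toNNReal hi_int.lintegral_lt_top.ne]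
  exact (lintegral_sub_left_eq_self (fun z => ENNReal.ofReal (f z)) x).le

/-- The near part of the kernel estimate. -/
lemma exists_setLIntegral_kernel_ball_le {n : ℕ} {s p : ℝ} (hn : 1 ≤ n) (hs : 0 < s) (hs1 : s < 1)
    (hp : 0 < p) :
    ∃ C : ℝ≥0, ∀ x ∈ ball (0 : Rn n) 4,
      ∫⁻ y in ball (0 : Rn n) 4,
        ENNReal.ofReal (‖x - y‖ ^ p / ‖x - y‖ ^ ((n : ℝ) + s * p)) ≤ C := by
  obtain ⟨C, hC⟩ := exists_lintegral_truncatedKernel_le hn hs hs1 hp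
  refine ⟨(8 ^ p : ℝ).toNNReal * C, fun x hx => ?_⟩
  push_cast
  refine le_trans ?_ (mul_le_mul_right (hC x) _)
  rw [← lintegral_const_mul _ (by fun_prop)]
  refine (setLIntegral_mono' measurableSet_ball fun y hy => ?_).trans
    (setLIntegral_le_lintegral _ _)
  change _ ≤ ENNReal.ofReal (8 ^ p) * _
  rw [← ENNReal.ofReal_mul (by positivity)]
  refine ENNReal.ofReal_le_ofReal ?_
  rw [← mul_div_assoc]
  refine div_le_div_of_nonneg_right ?_ (by positivity)
  have hxy : ‖x - y‖ ≤ 8 := by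
    have := norm_sub_le x y
    simp only [mem_ball, dist_zero_right] at hx hy
    linarith
  rcases le_total 1 (‖x - y‖ ^ p) with h | h
  · rw [min_eq_left h, mul_one]; gcongr
  · rw [min_eq_right h]
    exact le_mul_of_one_le_left (by positivity) (Real.one_le_rpow (by norm_num) hp.le)

lemma exists_setLIntegral_kernel_compl_le {n : ℕ} {s p : ℝ} (hn : 1 ≤ n) (hs : 0 < s) (hs1 : s < 1)
    (hp : 0 < p) :
    ∃ C : ℝ≥0, ∫⁻ y in (ball (0 : Rn n) 4)ᶜ,
        ENNReal.ofReal (1 / ‖y‖ ^ ((n : ℝ) + s * p)) ≤ C := by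
  obtain ⟨C, hC⟩ := exists_lintegral_truncatedKernel_le hn hs hs1 hp
  refine ⟨C, le_trans ?_ (hC 0)⟩
  refine (setLIntegral_mono' measurableSet_ball.compl fun y hy => ?_).trans
    (setLIntegral_le_lintegral _ _)
  have hy4 : 4 ≤ ‖y‖ := by simpa using hy
  rw [zero_sub, norm_neg, min_eq_left (Real.one_le_rpow (by linarith) hp.le)]

lemma add_rpow_le_two_rpow_mul {a b q : ℝ} (ha : 0 ≤ a) (hb : 0 ≤ b) (hq : 0 ≤ q) :
    (a + b) ^ q ≤ 2 ^ q * (a ^ q + b ^ q) := by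
  have h1 : a + b ≤ 2 * max a b := by
    linarith [le_max_left a b, le_max_right a b]
  have hm : 0 ≤ max a b := ha.trans (le_max_left _ _)
  calc (a + b) ^ q ≤ (2 * max a b) ^ q := Real.rpow_le_rpow (by positivity) h1 hq
    _ = 2 ^ q * (max a b) ^ q := Real.mul_rpow (by norm_num) hm
    _ ≤ 2 ^ q * (a ^ q + b ^ q) := by
      gcongr
      rcases max_choice a b with h | h <;> rw [h]
      · linarith [Real.rpow_nonneg hb q]
      · linarith [Real.rpow_nonneg ha q]

/-- Upper bound for the aligned energy of a nonnegative function supported in `A ⊆ B₃`. -/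
lemma exists_alignedEnergy_le {n : ℕ} {s p : ℝ} (hn : 1 ≤ n) (hs : 0 < s) (hs1 : s < 1)
    (hp : 1 < p) :
    ∃ C : ℝ≥0, ∀ (u φ W : Rn n → ℝ) (A : Set (Rn n)), Measurable u → MeasurableSet A →
      (∀ x ∈ ball 0 4, 0 ≤ u x) →
      (∫⁻ y in (ball (0 : Rn n) 4)ᶜ,
        ENNReal.ofReal ((max (-u y) 0) ^ (p - 1) / ‖y‖ ^ ((n : ℝ) + s * p))) ≤ 1 →
      A ⊆ ball 0 3 → (∀ x ∉ A, φ x = 0) → (∀ x, 0 ≤ φ x) →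
      (∀ x ∈ A, φ x * (1 + u x) ^ (p - 1) ≤ W x) →
      (∀ x ∈ A, ∀ y ∈ ball 0 4, u y < u x → φ y < φ x →
        (u x - u y) ^ (p - 1) * (φ x - φ y) ≤ W x * ‖x - y‖ ^ p) →
      alignedEnergy n s p u φ ≤ C * ∫⁻ x in A, ENNReal.ofReal (W x) := by
  obtain ⟨C₁, hC₁⟩ := exists_setLIntegral_kernel_ball_le hn hs hs1 (zero_lt_one.trans hp)
  obtain ⟨C₂, hC₂⟩ := exists_setLIntegral_kernel_compl_le hn hs hs1 (zero_lt_one.trans hp)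
  have hp0 : 0 < p := zero_lt_one.trans hp
  have hα : 0 < (n : ℝ) + s * p := by positivity
  set α := (n : ℝ) + s * p with hαdef
  set c₃ : ℝ := 2 ^ (p - 1) * 4 ^ α with hc₃
  have hc₃0 : 0 ≤ c₃ := by positivity
  refine ⟨C₁ + c₃.toNNReal * (C₂ + 1), fun u φ W A hu hA hu0 htail hA3 hφA hφ0 hW hW' => ?_⟩
  rw [← lintegral_const_mul' _ _ ENNReal.coe_ne_top, ← lintegral_indicator hA]
  refine lintegral_mono fun x => ?_
  by_cases hx : x ∈ A
  swap
  · rw [indicator_of_notMem hx, nonpos_iff_eq_zero]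
    rw [lintegral_eq_zero_iff' (by rw [hφA x hx]; simp [hφ0]), hφA x hx]
    exact ae_of_all _ fun y => by simp [hφ0 y]
  rw [indicator_of_mem hx]
  have hx3 : ‖x‖ < 3 := by simpa using hA3 hx
  have hx4 : x ∈ ball (0 : Rn n) 4 := by simp; linarith
  have hux : 0 ≤ u x := hu0 x hx4
  have hw1 : 1 ≤ (1 + u x) ^ (p - 1) := Real.one_le_rpow (by linarith) (by linarith)
  have hφW : φ x ≤ W x := (le_mul_of_one_le_right (hφ0 x) hw1).trans (hW x hx)
  have hW0 : 0 ≤ W x := (hφ0 x).trans hφW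
  rw [← lintegral_add_compl _ (measurableSet_ball (x := (0 : Rn n)) (ε := 4))]
  have hnear : ∫⁻ y in ball (0 : Rn n) 4, ENNReal.ofReal
      ((max (u x - u y) 0) ^ (p - 1) * max (φ x - φ y) 0 / ‖x - y‖ ^ α) ≤
      C₁ * ENNReal.ofReal (W x) := by
    rw [mul_comm]
    refine le_trans ?_ (mul_le_mul_right (hC₁ x hx4) _)
    rw [← lintegral_const_mul _ (by fun_prop)]
    refine setLIntegral_mono' measurableSet_ball fun y hy => ?_
    rw [← ENNReal.ofReal_mul hW0]
    refine ENNReal.ofReal_le_ofReal ?_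
    rw [← mul_div_assoc]
    refine div_le_div_of_nonneg_right ?_ (by positivity)
    rcases le_or_gt (u x) (u y) with h | h
    · rw [max_eq_right (by linarith), Real.zero_rpow (by linarith), zero_mul]; positivity
    rcases le_or_gt (φ x) (φ y) with h' | h'
    · rw [max_eq_right (a := φ x - φ y) (by linarith), mul_zero]; positivity
    rw [max_eq_left (by linarith), max_eq_left (by linarith)]
    exact hW' x hx y hy h h'
  have hfar : ∫⁻ y in (ball (0 : Rn n) 4)ᶜ, ENNReal.ofReal
      ((max (u x - u y) 0) ^ (p - 1) * max (φ x - φ y) 0 / ‖x - y‖ ^ α) ≤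
      ENNReal.ofReal (c₃ * W x) * (C₂ + 1) := by
    refine le_trans ?_ (mul_le_mul_right (add_le_add hC₂ htail) _)
    rw [← lintegral_add_left (by fun_prop), ← lintegral_const_mul _ (by fun_prop)]
    refine setLIntegral_mono' measurableSet_ball.compl fun y hy => ?_
    have hy4 : 4 ≤ ‖y‖ := by simpa using hy
    have hy0 : φ y = 0 := hφA y fun h => by
      have : ‖y‖ < 3 := by simpa using hA3 h
      linarith
    rw [hy0, sub_zero, max_eq_left (hφ0 x), ← ENNReal.ofReal_add (by positivity) (by positivity),
      ← ENNReal.ofReal_mul (by positivity), ← add_div]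
    refine ENNReal.ofReal_le_ofReal ?_
    have hxy : ‖y‖ / 4 ≤ ‖x - y‖ := by
      have := norm_sub_norm_le y x
      rw [norm_sub_rev] at this
      linarith
    have hk : 1 / ‖x - y‖ ^ α ≤ 4 ^ α / ‖y‖ ^ α := by
      rw [← Real.div_rpow (by norm_num) (by positivity), ← Real.one_rpow α,
        ← Real.div_rpow (by norm_num) (by positivity)]
      refine Real.rpow_le_rpow (by positivity) ?_ hα.le
      rw [div_le_div_iff₀ (by linarith) (by linarith)]
      linarith
    have hm : (max (u x - u y) 0) ^ (p - 1) ≤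
        2 ^ (p - 1) * ((1 + u x) ^ (p - 1) + (max (-u y) 0) ^ (p - 1)) := by
      refine le_trans ?_ (add_rpow_le_two_rpow_mul (by linarith) (le_max_right _ _) (by linarith))
      refine Real.rpow_le_rpow (le_max_right _ _) ?_ (by linarith)
      have h1 := le_max_left (-u y) 0
      have h2 := le_max_right (-u y) 0
      exact max_le (by linarith) (by linarith)
    have hv0 : 0 ≤ (max (-u y) 0) ^ (p - 1) := by positivity
    calc (max (u x - u y) 0) ^ (p - 1) * φ x / ‖x - y‖ ^ α
        = ((max (u x - u y) 0) ^ (p - 1) * φ x) * (1 / ‖x - y‖ ^ α) := by ring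
      _ ≤ (2 ^ (p - 1) * ((1 + u x) ^ (p - 1) + (max (-u y) 0) ^ (p - 1)) * φ x) *
          (4 ^ α / ‖y‖ ^ α) := by
        have := hφ0 x
        gcongr
      _ = c₃ * (φ x * (1 + u x) ^ (p - 1) + φ x * (max (-u y) 0) ^ (p - 1)) / ‖y‖ ^ α := by
        rw [hc₃]; ring
      _ ≤ c₃ * (W x + W x * (max (-u y) 0) ^ (p - 1)) / ‖y‖ ^ α := by
        have := hW x hx
        gcongr
      _ = c₃ * W x * ((1 + (max (-u y) 0) ^ (p - 1)) / ‖y‖ ^ α) := by ring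
  refine (add_le_add hnear hfar).trans (le_of_eq ?_)
  rw [ENNReal.ofReal_mul hc₃0]
  push_cast
  change _ = ((C₁ : ℝ≥0∞) + ENNReal.ofReal c₃ * _) * _
  ring

/-- Test functions supported in `B₃` that inherit the regularity of `u`. -/
structure AdmissibleTest (n : ℕ) (u φ : Rn n → ℝ) : Prop where
  measurable : Measurable φ
  nonneg : ∀ x, 0 ≤ φ x
  bdd : ∃ N, ∀ x, φ x ≤ N
  eq_zero : ∀ x ∉ ball 0 3, φ x = 0
  lip : ∃ L, 0 ≤ L ∧ ∀ x y, |φ x - φ y| ≤ L * (|u x - u y| + ‖x - y‖)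

/-- The energy inequality satisfied, after rescaling to the unit ball, by a supersolution that is
nonnegative in `B₄`, has tail at most one and whose right-hand side has mass `M` in `B₁`. -/
structure UnitSupersolution (n : ℕ) (s p : ℝ) (C₀ : ℝ≥0) (M : ℝ) (u : Rn n → ℝ) : Prop where
  measurable : Measurable u
  nonneg : ∀ x ∈ ball 0 4, 0 ≤ u x
  tail_le : (∫⁻ y in (ball (0 : Rn n) 4)ᶜ,
    ENNReal.ofReal ((max (-u y) 0) ^ (p - 1) / ‖y‖ ^ ((n : ℝ) + s * p))) ≤ 1
  energy : ∀ φ, AdmissibleTest n u φ → ∀ m, 0 ≤ m → (∀ x ∈ ball 0 1, m ≤ φ x) →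
    ENNReal.ofReal (m * M) + alignedEnergy n s p u (fun x => -φ x) ≤ C₀ * alignedEnergy n s p u φ

lemma UnitSupersolution.energy_le {n : ℕ} {s p M : ℝ} {C₀ : ℝ≥0} {u φ : Rn n → ℝ}
    (hu : UnitSupersolution n s p C₀ M u) (hφ : AdmissibleTest n u φ) :
    alignedEnergy n s p u (fun x => -φ x) ≤ C₀ * alignedEnergy n s p u φ :=
  le_add_self.trans (hu.energy φ hφ 0 le_rfl fun x _ => hφ.nonneg x)

lemma abs_max_zero_sub_max_zero_le (a b : ℝ) : |max a 0 - max b 0| ≤ |a - b| := by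
  simpa using abs_max_sub_max_le_abs a b 0

lemma admissibleTest_truncation {n : ℕ} {u V : Rn n → ℝ} {G : ℝ → ℝ} {c L N : ℝ}
    (hu : Measurable u) (hV : Measurable V) (hG : Measurable G) (hc : 0 ≤ c) (hL : 0 ≤ L)
    (hVlip : ∀ x y, |V x - V y| ≤ c * ‖x - y‖) (hVN : ∀ x, V x ≤ N)
    (hV0 : ∀ x ∉ ball 0 3, V x ≤ 0) (hG0 : ∀ t, 0 ≤ t → 0 ≤ G t)
    (hGlip : ∀ a b, 0 ≤ a → 0 ≤ b → |G a - G b| ≤ L * |a - b|) :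
    AdmissibleTest n u (fun x => max (V x - G (max (u x) 0)) 0) where
  measurable := by fun_prop
  nonneg x := le_max_right _ _
  bdd := ⟨max N 0, fun x => max_le_max_right _ (by
    linarith [hVN x, hG0 _ (le_max_right (u x) 0)])⟩
  eq_zero x hx := max_eq_right (by linarith [hV0 x hx, hG0 _ (le_max_right (u x) 0)])
  lip := by
    refine ⟨c + L, by positivity, fun x y => ?_⟩
    refine (abs_max_zero_sub_max_zero_le _ _).trans ?_
    have h1 := hVlip x y
    have h2 := hGlip _ _ (le_max_right (u x) 0) (le_max_right (u y) 0)
    have h3 := abs_max_zero_sub_max_zero_le (u x) (u y)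
    have h4 : L * |max (u x) 0 - max (u y) 0| ≤ L * |u x - u y| := by gcongr
    have h5 : |V x - G (max (u x) 0) - (V y - G (max (u y) 0))| ≤
        |V x - V y| + |G (max (u x) 0) - G (max (u y) 0)| := by
      rw [sub_sub_sub_comm]; exact abs_sub _ _
    have h6 : 0 ≤ c * |u x - u y| := by positivity
    have h7 : 0 ≤ L * ‖x - y‖ := by positivity
    linarith

lemma abs_cone_sub_le {n : ℕ} {c : ℝ} (hc : 0 ≤ c) (R : ℝ) (x y : Rn n) :
    |c * (R - ‖x‖) - c * (R - ‖y‖)| ≤ c * ‖x - y‖ := by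
  rw [← mul_sub, abs_mul, abs_of_nonneg hc, sub_sub_sub_cancel_left, norm_sub_rev x y]
  exact mul_le_mul_of_nonneg_left (abs_norm_sub_norm_le y x) hc

/-- The radius of a ball of volume `a`. -/
def volumeRadius (n : ℕ) (a : ℝ) : ℝ :=
  (a / (volume (ball (0 : Rn n) 1)).toReal) ^ (1 / (n : ℝ))

lemma toReal_volume_unitBall_pos (n : ℕ) : 0 < (volume (ball (0 : Rn n) 1)).toReal :=
  ENNReal.toReal_pos (measure_ball_pos _ _ one_pos).ne' measure_ball_lt_top.ne

lemma volumeRadius_pos {n : ℕ} {a : ℝ} (ha : 0 < a) : 0 < volumeRadius n a :=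
  Real.rpow_pos_of_pos (div_pos ha (toReal_volume_unitBall_pos n)) _

lemma volume_ball_volumeRadius {n : ℕ} (hn : 1 ≤ n) {a : ℝ} (ha : 0 < a) (x : Rn n) :
    volume (ball x (volumeRadius n a)) = ENNReal.ofReal a := by
  have hω := toReal_volume_unitBall_pos n
  have hn' : (n : ℝ) ≠ 0 := by positivity
  rw [Measure.addHaar_ball_of_pos _ _ (volumeRadius_pos ha)]
  rw [← ENNReal.ofReal_toReal (measure_ball_lt_top (μ := volume) (x := (0 : Rn n)) (r := 1)).ne,
    ← ENNReal.ofReal_mul (pow_nonneg (volumeRadius_pos ha).le _)]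
  congr 1
  rw [finrank_euclideanSpace, Fintype.card_fin, volumeRadius, ← Real.rpow_natCast,
    ← Real.rpow_mul (by positivity), one_div, inv_mul_cancel₀ hn', Real.rpow_one]
  field_simp

lemma volumeRadius_rpow {n : ℕ} {a : ℝ} (ha : 0 < a) (β : ℝ) :
    volumeRadius n a ^ β = (volume (ball (0 : Rn n) 1)).toReal ^ (-(β / n)) * a ^ (β / n) := by
  have hω := toReal_volume_unitBall_pos n
  rw [volumeRadius, ← Real.rpow_mul (by positivity), Real.div_rpow ha.le hω.le,
    Real.rpow_neg hω.le, one_div_mul_eq_div, div_eq_inv_mul]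

lemma volumeRadius_le_one {n : ℕ} {a : ℝ} (ha : 0 ≤ a)
    (h : a ≤ (volume (ball (0 : Rn n) 1)).toReal) : volumeRadius n a ≤ 1 :=
  Real.rpow_le_one (div_nonneg ha ENNReal.toReal_nonneg)
    (div_le_one_of_le₀ h ENNReal.toReal_nonneg) (by positivity)

lemma le_volume_ball_volumeRadius_diff {n : ℕ} (hn : 1 ≤ n) {a : ℝ} (ha : 0 < a) (x : Rn n)
    {A : Set (Rn n)} (hA : volume A ≤ ENNReal.ofReal a) :
    ENNReal.ofReal a ≤ volume (ball x (volumeRadius n (2 * a)) \ A) := by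
  refine le_trans ?_ le_measure_sdiff
  rw [volume_ball_volumeRadius hn (by positivity)]
  refine ENNReal.le_sub_of_add_le_right (ne_top_of_le_ne_top ENNReal.ofReal_ne_top hA) ?_
  calc ENNReal.ofReal a + volume A ≤ ENNReal.ofReal a + ENNReal.ofReal a := by gcongr
    _ = ENNReal.ofReal (2 * a) := by rw [← ENNReal.ofReal_add ha.le ha.le, two_mul]

/-- Sublevel sets of `u` relative to a cone. -/
def coneSublevel (n : ℕ) (u : Rn n → ℝ) (t : ℝ) : Set (Rn n) :=
  {x | x ∈ ball 0 2 ∧ u x < 2 * (2 - ‖x‖) - t}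

lemma measurableSet_coneSublevel {n : ℕ} {u : Rn n → ℝ} (hu : Measurable u) (t : ℝ) :
    MeasurableSet (coneSublevel n u t) :=
  measurableSet_ball.inter (measurableSet_lt hu (by fun_prop))

lemma volume_coneSublevel_ne_top {n : ℕ} (u : Rn n → ℝ) (t : ℝ) :
    volume (coneSublevel n u t) ≠ ⊤ :=
  measure_ne_top_of_subset (fun _ hx => hx.1) (measure_ball_lt_top (x := (0 : Rn n)) (r := 2)).ne

lemma coneSublevel_anti {n : ℕ} (u : Rn n → ℝ) {t t' : ℝ} (h : t ≤ t') :
    coneSublevel n u t' ⊆ coneSublevel n u t :=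
  fun _ hx => ⟨hx.1, hx.2.trans_le (by linarith)⟩

lemma exists_rpow_mul_volume_coneSublevel_le {n : ℕ} {s p : ℝ} (hn : 1 ≤ n) (hs : 0 < s)
    (hs1 : s < 1) (hp : 1 < p) (C₀ : ℝ≥0) :
    ∃ C : ℝ, 0 ≤ C ∧ ∀ (u : Rn n → ℝ) (M t h : ℝ), UnitSupersolution n s p C₀ M u →
      0 ≤ t → 0 < h →
      2 * (volume (coneSublevel n u t)).toReal ≤ (volume (ball (0 : Rn n) 1)).toReal →
      h ^ p * (volume (coneSublevel n u (t + h))).toReal ≤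
        C * (volume (coneSublevel n u t)).toReal ^ (1 + s * p / n) := by
  obtain ⟨C₁, hC₁⟩ := exists_setLIntegral_kernel_ball_le hn hs hs1 (zero_lt_one.trans hp)
  obtain ⟨C₂, hC₂⟩ := exists_alignedEnergy_le hn hs hs1 hp
  have hp0 : 0 < p := zero_lt_one.trans hp
  have hα : 0 < (n : ℝ) + s * p := by positivity
  set α := (n : ℝ) + s * p with hαdef
  set Q : ℝ := 4 * 5 ^ (p - 1) + 2 ^ p with hQ
  set c₁ : ℝ := 2 ^ (p - 1) * (C₀ * (C₂ * Q)) + 4 ^ p * C₁ with hc₁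
  have hc₁0 : 0 ≤ c₁ := by positivity
  set ω := (volume (ball (0 : Rn n) 1)).toReal with hω
  refine ⟨c₁ * (ω ^ (-(α / n)) * 2 ^ (α / n)), by positivity, fun u M t h hu ht hh hsmall => ?_⟩
  set A := coneSublevel n u t with hAdef
  set A' := coneSublevel n u (t + h) with hA'def
  have hA : MeasurableSet A := measurableSet_coneSublevel hu.measurable t
  have hA' : MeasurableSet A' := measurableSet_coneSublevel hu.measurable (t + h)
  have hAtop : volume A ≠ ⊤ := volume_coneSublevel_ne_top u t
  have hA'A : A' ⊆ A := coneSublevel_anti u (by linarith)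
  have hα' : 1 + s * p / n = α / n := by
    have : (n : ℝ) ≠ 0 := by positivity
    rw [hαdef]; field_simp
  rcases eq_or_ne (volume A) 0 with h0 | h0
  · rw [measure_mono_null hA'A h0]
    simp only [ENNReal.toReal_zero, mul_zero]; positivity
  set a := (volume A).toReal with ha
  have ha0 : 0 < a := ENNReal.toReal_pos h0 hAtop
  have haA : volume A = ENNReal.ofReal a := (ENNReal.ofReal_toReal hAtop).symm
  set ρ := volumeRadius n (2 * a) with hρ
  have hρ0 : 0 < ρ := volumeRadius_pos (by positivity)
  have hρ1 : ρ ≤ 1 := volumeRadius_le_one (by positivity) hsmall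
  set φ : Rn n → ℝ := fun x => max (2 * (2 - ‖x‖) - t - max (u x) 0) 0 with hφ
  have hφm : Measurable φ := by have := hu.measurable; fun_prop
  have hadm : AdmissibleTest n u φ := by
    refine admissibleTest_truncation (V := fun x => 2 * (2 - ‖x‖) - t) (G := fun t => t) (c := 2)
      (L := 1) (N := 4) hu.measurable (by fun_prop) measurable_id (by norm_num) (by norm_num)
      ?_ ?_ ?_ (fun _ h => h) (fun a b _ _ => by simp)
    · intro x y
      rw [sub_sub_sub_cancel_right]
      exact abs_cone_sub_le (by norm_num) 2 x y
    · intro x; linarith [norm_nonneg x]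
    · intro x hx
      have : 3 ≤ ‖x‖ := by simpa using hx
      linarith
  have hφA : ∀ x ∉ A, φ x = 0 := by
    intro x hx
    refine max_eq_right ?_
    by_contra! hlt
    have h1 := le_max_right (u x) 0
    have h2 := le_max_left (u x) 0
    refine hx ⟨?_, by linarith⟩
    rw [mem_ball, dist_zero_right]; linarith
  have hu2 : ∀ x ∈ ball (0 : Rn n) 2, 0 ≤ u x := fun x hx =>
    hu.nonneg x (ball_subset_ball (by norm_num) hx)
  have hupper : alignedEnergy n s p u φ ≤ C₂ * ENNReal.ofReal (Q * a) := by
    refine (hC₂ u φ (fun _ => Q) A hu.measurable hA hu.nonneg hu.tail_le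
      (fun x hx => ball_subset_ball (by norm_num) hx.1) hφA (fun x => le_max_right _ _) ?_ ?_).trans
      ?_
    · intro x hx
      have hux := hu2 x hx.1
      have hux4 : u x ≤ 4 := by linarith [hx.2, norm_nonneg x]
      have h4 : φ x ≤ 4 := max_le (by linarith [norm_nonneg x, le_max_right (u x) 0]) (by norm_num)
      have h5 : (1 + u x) ^ (p - 1) ≤ 5 ^ (p - 1) :=
        Real.rpow_le_rpow (by linarith) (by linarith) (by linarith)
      have h6 : (0 : ℝ) < 2 ^ p := by positivity
      have h7 : φ x * (1 + u x) ^ (p - 1) ≤ 4 * 5 ^ (p - 1) := by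
        have : 0 ≤ (1 + u x) ^ (p - 1) := by positivity
        gcongr
      linarith
    · intro x hx y hy huxy hφxy
      have hux := hu2 x hx.1
      have huy := hu.nonneg y hy
      have hcone := (abs_le.1 (abs_cone_sub_le (n := n) (c := 2) (by norm_num) 2 x y)).2
      have h1 : φ x = 2 * (2 - ‖x‖) - t - u x := by
        have := hx.2
        simp only [hφ, max_eq_left hux]; exact max_eq_left (by linarith)
      have h2 : 2 * (2 - ‖y‖) - t - u y ≤ φ y := by
        simp only [hφ, max_eq_left huy]; exact le_max_left _ _
      have h3 : u x - u y ≤ 2 * ‖x - y‖ := by linarith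
      have h4 : φ x - φ y ≤ 2 * ‖x - y‖ := by linarith
      have h5 : (u x - u y) ^ (p - 1) ≤ (2 * ‖x - y‖) ^ (p - 1) :=
        Real.rpow_le_rpow (by linarith) h3 (by linarith)
      have h6 : 0 ≤ φ x - φ y := by linarith
      have h7 : (0 : ℝ) < 2 * ‖x - y‖ := by linarith
      calc (u x - u y) ^ (p - 1) * (φ x - φ y)
          ≤ (2 * ‖x - y‖) ^ (p - 1) * (2 * ‖x - y‖) := by gcongr
        _ = 2 ^ p * ‖x - y‖ ^ p := by
          rw [← Real.rpow_add_one h7.ne', sub_add_cancel,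
            Real.mul_rpow (by norm_num) (norm_nonneg _)]
        _ ≤ Q * ‖x - y‖ ^ p := by
          gcongr
          rw [hQ]
          have : (0 : ℝ) < 5 ^ (p - 1) := by positivity
          linarith
    · rw [setLIntegral_const, haA, ← ENNReal.ofReal_mul (by positivity)]
  have henergy := (hu.energy_le hadm).trans (mul_le_mul_right hupper _)
  have hpoint : ∀ y ∈ A', ∀ x ∈ ball y ρ \ A, ENNReal.ofReal (h ^ p / ρ ^ α) ≤
      ENNReal.ofReal (2 ^ (p - 1)) * ENNReal.ofReal ((max (u x - u y) 0) ^ (p - 1) *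
        max (-φ x - -φ y) 0 / ‖x - y‖ ^ α) +
      ENNReal.ofReal (4 ^ p) * (ball (0 : Rn n) 4).indicator
        (fun x => ENNReal.ofReal (‖y - x‖ ^ p / ‖y - x‖ ^ α)) x := by
    intro y hy x hx
    have hxy : ‖x - y‖ < ρ := by simpa [dist_eq_norm] using hx.1
    have hy2 : ‖y‖ < 2 := by simpa using hy.1
    have hx4 : x ∈ ball (0 : Rn n) 4 := by
      rw [mem_ball, dist_zero_right]
      have := norm_sub_norm_le x y
      linarith
    have huy := hu2 y hy.1
    have hux := hu.nonneg x hx4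
    have hφx : φ x = 0 := hφA x hx.2
    have hφy : h ≤ φ y := by
      have h1 := hy.2
      have : 2 * (2 - ‖y‖) - t - u y ≤ φ y := by
        simp only [hφ, max_eq_left huy]; exact le_max_left _ _
      linarith
    have hne : x ≠ y := by
      rintro rfl; linarith
    have hxy0 : 0 < ‖x - y‖ := norm_pos_iff.2 (sub_ne_zero.2 hne)
    rw [indicator_of_mem hx4, ← ENNReal.ofReal_mul (by positivity),
      ← ENNReal.ofReal_mul (by positivity), ← ENNReal.ofReal_add (by positivity) (by positivity)]
    refine ENNReal.ofReal_le_ofReal ?_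
    rw [norm_sub_rev y x, ← mul_div_assoc, ← mul_div_assoc, ← add_div]
    have hnum : h ^ p ≤ 2 ^ (p - 1) * ((max (u x - u y) 0) ^ (p - 1) * max (-φ x - -φ y) 0) +
        4 ^ p * ‖x - y‖ ^ p := by
      rw [hφx, neg_zero, zero_sub, neg_neg, max_eq_left (by linarith : 0 ≤ φ y)]
      rcases le_total (h / 2) (u x - u y) with hc | hc
      · have h1 : h ^ p ≤ 2 ^ (p - 1) * (max (u x - u y) 0 ^ (p - 1) * φ y) := by
          rw [← mul_assoc, ← Real.mul_rpow (by norm_num) (le_max_right _ _)]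
          calc h ^ p = h ^ (p - 1) * h := by rw [← Real.rpow_add_one hh.ne', sub_add_cancel]
            _ ≤ _ := by
              have : h ≤ 2 * max (u x - u y) 0 := by
                linarith [le_max_left (u x - u y) 0]
              have h8 : 0 ≤ p - 1 := by linarith
              gcongr
        have h2 : 0 ≤ 4 ^ p * ‖x - y‖ ^ p := by positivity
        linarith
      · have hcone := (abs_le.1 (abs_cone_sub_le (n := n) (c := 2) (by norm_num) 2 y x)).2
        rw [norm_sub_rev y x] at hcone
        have hxA : ‖x‖ < 2 → 2 * (2 - ‖x‖) - t ≤ u x := by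
          intro h2
          by_contra! hlt
          exact hx.2 ⟨by simpa using h2, hlt⟩
        have hxA' : 2 * (2 - ‖x‖) - t ≤ u x := by
          rcases lt_or_ge ‖x‖ 2 with h2 | h2
          · exact hxA h2
          · linarith
        have h1 : h ≤ 4 * ‖x - y‖ := by
          have := hy.2
          linarith
        have h2 : h ^ p ≤ 4 ^ p * ‖x - y‖ ^ p := by
          rw [← Real.mul_rpow (by norm_num) (norm_nonneg _)]
          gcongr
        have h3 : 0 ≤ 2 ^ (p - 1) * (max (u x - u y) 0 ^ (p - 1) * φ y) := by
          have : 0 ≤ φ y := by linarith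
          positivity
        linarith
    have hφy0 : 0 ≤ φ y := by linarith
    gcongr
  have hlow : ENNReal.ofReal (h ^ p / ρ ^ α) * ENNReal.ofReal a * volume A' ≤
      ENNReal.ofReal (c₁ * a) := by
    calc ENNReal.ofReal (h ^ p / ρ ^ α) * ENNReal.ofReal a * volume A'
        = ∫⁻ y in A', ENNReal.ofReal (h ^ p / ρ ^ α) * ENNReal.ofReal a := by
          rw [setLIntegral_const]
      _ ≤ ∫⁻ y in A', ∫⁻ x in ball y ρ \ A, ENNReal.ofReal (h ^ p / ρ ^ α) := by
          refine lintegral_mono fun y => ?_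
          rw [setLIntegral_const]
          exact mul_le_mul_right (le_volume_ball_volumeRadius_diff hn ha0 y haA.le) _
      _ ≤ ∫⁻ y in A', (ENNReal.ofReal (2 ^ (p - 1)) * (∫⁻ x, ENNReal.ofReal
            ((max (u x - u y) 0) ^ (p - 1) * max (-φ x - -φ y) 0 / ‖x - y‖ ^ α)) +
            ENNReal.ofReal (4 ^ p) * C₁) := by
          refine setLIntegral_mono' hA' fun y hy => ?_
          refine (setLIntegral_mono' (measurableSet_ball.diff hA) (hpoint y hy)).trans ?_
          refine (setLIntegral_le_lintegral _ _).trans ?_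
          have hum := hu.measurable
          rw [lintegral_add_left (by fun_prop), lintegral_const_mul _ (by fun_prop),
            lintegral_const_mul' _ _ ENNReal.ofReal_ne_top, lintegral_indicator measurableSet_ball]
          refine add_le_add le_rfl (mul_le_mul_right (hC₁ y ?_) _)
          exact ball_subset_ball (by norm_num) hy.1
      _ ≤ ENNReal.ofReal (2 ^ (p - 1)) * alignedEnergy n s p u (fun x => -φ x) +
            ENNReal.ofReal (4 ^ p) * C₁ * volume A := by
          rw [lintegral_add_right _ measurable_const, setLIntegral_const,
            lintegral_const_mul' _ _ ENNReal.ofReal_ne_top]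
          refine add_le_add (mul_le_mul_right ?_ _) (mul_le_mul_right (measure_mono hA'A) _)
          refine (setLIntegral_le_lintegral _ _).trans (le_of_eq ?_)
          rw [alignedEnergy, lintegral_lintegral_swap]
          have hum := hu.measurable
          refine Measurable.aemeasurable ?_
          fun_prop
      _ ≤ ENNReal.ofReal (2 ^ (p - 1)) * (C₀ * (C₂ * ENNReal.ofReal (Q * a))) +
            ENNReal.ofReal (4 ^ p) * C₁ * ENNReal.ofReal a := by
          rw [haA]
          gcongr
      _ = ENNReal.ofReal (c₁ * a) := by
          rw [← ENNReal.ofReal_coe_nnreal (p := C₀), ← ENNReal.ofReal_coe_nnreal (p := C₁),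
            ← ENNReal.ofReal_coe_nnreal (p := C₂), ← ENNReal.ofReal_mul (by positivity),
            ← ENNReal.ofReal_mul (by positivity), ← ENNReal.ofReal_mul (by positivity),
            ← ENNReal.ofReal_mul (by positivity), ← ENNReal.ofReal_mul (by positivity),
            ← ENNReal.ofReal_add (by positivity) (by positivity)]
          congr 1
          rw [hc₁]; ring
  have hA'top : volume A' ≠ ⊤ := volume_coneSublevel_ne_top u (t + h)
  rw [← ENNReal.ofReal_toReal hA'top, ← ENNReal.ofReal_mul (by positivity),
    ← ENNReal.ofReal_mul (by positivity), ENNReal.ofReal_le_ofReal_iff (by positivity)] at hlow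
  have hρα : 0 < ρ ^ α := by positivity
  have h1 : h ^ p * (volume A').toReal ≤ c₁ * ρ ^ α := by
    rw [div_mul_eq_mul_div, div_mul_eq_mul_div, div_le_iff₀ hρα] at hlow
    nlinarith
  refine h1.trans (le_of_eq ?_)
  rw [hρ, volumeRadius_rpow (by positivity), hα', Real.mul_rpow (by norm_num) ha0.le]
  ring

lemma tendsto_zero_of_superlinear_recursion {b C δ β : ℝ} (hb : 1 < b) (hC : 0 < C)
    (hδ : 0 < δ) (hβ : 0 < β) :
    ∃ ν, 0 < ν ∧ ∀ a : ℕ → ℝ, (∀ j, 0 ≤ a j) →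
      (∀ j, a j ≤ δ → a (j + 1) ≤ C * b ^ j * a j ^ (1 + β)) → a 0 ≤ ν →
      Tendsto a atTop (𝓝 0) := by
  have hb0 : 0 < b := zero_lt_one.trans hb
  set θ : ℝ := b ^ (-(1 / β)) with hθ
  have hθ0 : 0 < θ := Real.rpow_pos_of_pos hb0 _
  have hθ1 : θ < 1 := Real.rpow_lt_one_of_one_lt_of_neg hb (by have := one_div_pos.2 hβ; linarith)
  have hθb : b * θ ^ β = 1 := by
    rw [hθ, ← Real.rpow_mul hb0.le, neg_mul, one_div_mul_cancel hβ.ne', Real.rpow_neg_one,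
      mul_inv_cancel₀ hb0.ne']
  set ν : ℝ := min δ ((θ / C) ^ (1 / β)) with hν
  have hν0 : 0 < ν := lt_min hδ (by positivity)
  have hνβ : C * ν ^ β ≤ θ := by
    have h1 : ν ^ β ≤ ((θ / C) ^ (1 / β)) ^ β :=
      Real.rpow_le_rpow hν0.le (min_le_right _ _) hβ.le
    rw [← Real.rpow_mul (by positivity), one_div_mul_cancel hβ.ne', Real.rpow_one] at h1
    calc C * ν ^ β ≤ C * (θ / C) := by gcongr
      _ = θ := by field_simp
  refine ⟨ν, hν0, fun a ha hrec h0 => ?_⟩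
  have key : ∀ j, a j ≤ ν * θ ^ j := by
    intro j
    induction j with
    | zero => simpa using h0
    | succ j ih =>
      have hle : a j ≤ δ := ih.trans ((mul_le_of_le_one_right hν0.le
        (pow_le_one₀ hθ0.le hθ1.le)).trans (min_le_left _ _))
      refine (hrec j hle).trans ?_
      calc C * b ^ j * a j ^ (1 + β) ≤ C * b ^ j * (ν * θ ^ j) ^ (1 + β) := by
            have := ha j
            gcongr
        _ = (C * ν ^ β) * (b * θ ^ β) ^ j * (ν * θ ^ j) := by
            rw [Real.rpow_add (by positivity), Real.rpow_one, Real.mul_rpow hν0.le (by positivity),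
              mul_pow, ← Real.rpow_natCast (θ ^ β), ← Real.rpow_mul hθ0.le, mul_comm β,
              Real.rpow_mul hθ0.le, Real.rpow_natCast]
            ring
        _ ≤ θ * 1 ^ j * (ν * θ ^ j) := by
            rw [hθb]; gcongr
        _ = ν * θ ^ (j + 1) := by rw [one_pow]; ring
  refine squeeze_zero ha key ?_
  simpa using (tendsto_pow_atTop_nhds_zero_of_lt_one hθ0.le hθ1).const_mul ν

/-- If `u < 1` on a non-null part of `B₁`, then a sublevel set of `u` in `B₂` has definite
measure. -/
lemma exists_le_volume_coneSublevel {n : ℕ} {s p : ℝ} (hn : 1 ≤ n) (hs : 0 < s)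
    (hs1 : s < 1) (hp : 1 < p) (C₀ : ℝ≥0) :
    ∃ ν : ℝ, 0 < ν ∧ ∀ (u : Rn n → ℝ) (M : ℝ), UnitSupersolution n s p C₀ M u →
      volume ({x | u x < 1} ∩ ball 0 1) ≠ 0 → ν ≤ (volume (coneSublevel n u 0)).toReal := by
  obtain ⟨C, hC0, hC⟩ := exists_rpow_mul_volume_coneSublevel_le hn hs hs1 hp C₀
  have hω := toReal_volume_unitBall_pos n
  have hp0 : 0 < p := by linarith
  have hn0 : (0 : ℝ) < n := by positivity
  obtain ⟨ν, hν, hseq⟩ := tendsto_zero_of_superlinear_recursion (b := 2 ^ p)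
    (C := (C + 1) * 2 ^ p) (δ := (volume (ball (0 : Rn n) 1)).toReal / 2) (β := s * p / n)
    (Real.one_lt_rpow (by norm_num) hp0) (by positivity) (by positivity) (by positivity)
  refine ⟨ν, hν, fun u M hu hpos => ?_⟩
  by_contra! hlt
  set t : ℕ → ℝ := fun j => 1 - (1 / 2) ^ j with ht
  have htj : ∀ j, t (j + 1) = t j + (1 / 2) ^ (j + 1) := fun j => by simp only [ht]; ring
  have ht0 : ∀ j, 0 ≤ t j := fun j => sub_nonneg.2 (pow_le_one₀ (by norm_num) (by norm_num))
  have hlim := hseq (fun j => (volume (coneSublevel n u (t j))).toReal)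
    (fun j => ENNReal.toReal_nonneg) (fun j hj => ?_) (by simpa [ht] using hlt.le)
  swap
  · have h1 := hC u M (t j) ((1 / 2) ^ (j + 1)) hu (ht0 j) (by positivity) (by linarith)
    rw [← htj] at h1
    have h2 : ((1 / 2 : ℝ) ^ (j + 1)) ^ p = ((2 ^ p) ^ (j + 1))⁻¹ := by
      rw [← Real.rpow_natCast, ← Real.rpow_mul (by norm_num), mul_comm, Real.rpow_mul (by norm_num),
        Real.rpow_natCast, one_div, Real.inv_rpow (by norm_num), inv_pow]
    rw [h2, inv_mul_le_iff₀ (by positivity)] at h1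
    refine h1.trans ?_
    have h3 : 0 ≤ (volume (coneSublevel n u (t j))).toReal ^ (1 + s * p / n) := by positivity
    have h4 : (0 : ℝ) < (2 ^ p) ^ (j + 1) := by positivity
    calc ((2 : ℝ) ^ p) ^ (j + 1) * (C * (volume (coneSublevel n u (t j))).toReal ^ (1 + s * p / n))
        ≤ (2 ^ p) ^ (j + 1) * ((C + 1) *
          (volume (coneSublevel n u (t j))).toReal ^ (1 + s * p / n)) := by
          gcongr; linarith
      _ = _ := by ring
  have hsub : ∀ j, {x | u x < 1} ∩ ball 0 1 ⊆ coneSublevel n u (t j) := by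
    intro j x hx
    have hx1 : ‖x‖ < 1 := by simpa using hx.2
    refine ⟨ball_subset_ball (by norm_num) hx.2, ?_⟩
    have h1 : u x < 1 := hx.1
    have h2 : (0 : ℝ) < (1 / 2) ^ j := by positivity
    simp only [ht]; linarith
  have hle : (volume ({x | u x < 1} ∩ ball 0 1)).toReal ≤ 0 :=
    ge_of_tendsto' hlim fun j =>
      ENNReal.toReal_mono (volume_coneSublevel_ne_top u _) (measure_mono (hsub j))
  have hgt : 0 < (volume ({x | u x < 1} ∩ ball 0 1)).toReal :=
    ENNReal.toReal_pos hpos (measure_ne_top_of_subset inter_subset_right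
      (measure_ball_lt_top (x := (0 : Rn n)) (r := 1)).ne)
  linarith

/-- The sharp weak Harnack inequality, obtained from the long-range interaction of `{u large}` with
a sublevel set of definite measure. -/
lemma exists_lintegral_one_add_rpow_le {n : ℕ} {s p : ℝ} (hn : 1 ≤ n) (hs : 0 < s)
    (hs1 : s < 1) (hp : 1 < p) (C₀ : ℝ≥0) :
    ∃ C : ℝ≥0, ∀ (u : Rn n → ℝ) (M : ℝ), UnitSupersolution n s p C₀ M u →
      volume ({x | u x < 1} ∩ ball 0 1) ≠ 0 →
      ∫⁻ x in ball (0 : Rn n) 3, ENNReal.ofReal ((1 + u x) ^ (p - 1)) ≤ C := by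
  obtain ⟨ν, hν, hνu⟩ := exists_le_volume_coneSublevel hn hs hs1 hp C₀
  obtain ⟨C₂, hC₂⟩ := exists_alignedEnergy_le hn hs hs1 hp
  have hp0 : 0 < p := zero_lt_one.trans hp
  have hα : 0 < (n : ℝ) + s * p := by positivity
  set α := (n : ℝ) + s * p with hαdef
  set Q : ℝ := 15 * 16 ^ (p - 1) + 5 ^ p with hQ
  set c : ℝ := 4 ^ (p - 1) * 10 ^ α / 5 with hc
  set b : ℝ≥0∞ := volume (ball (0 : Rn n) 3) with hb
  have hbtop : b ≠ ⊤ := measure_ball_lt_top.ne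
  set X : ℝ≥0∞ := (ENNReal.ofReal (16 ^ (p - 1)) * b * b +
    ENNReal.ofReal c * (C₀ * (C₂ * (ENNReal.ofReal Q * b)))) / ENNReal.ofReal ν with hX
  have hνE : ENNReal.ofReal ν ≠ 0 := (ENNReal.ofReal_pos.2 hν).ne'
  have hXtop : X ≠ ⊤ := by
    refine ENNReal.div_ne_top ?_ hνE
    simp only [ENNReal.add_ne_top]
    constructor <;> exact (by finiteness)
  refine ⟨X.toNNReal, fun u M hu hpos => ?_⟩
  rw [ENNReal.coe_toNNReal hXtop, hX, ENNReal.le_div_iff_mul_le (Or.inl hνE)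
    (Or.inl ENNReal.ofReal_ne_top)]
  set A := coneSublevel n u 0 with hA
  have hAm : MeasurableSet A := measurableSet_coneSublevel hu.measurable 0
  have hum := hu.measurable
  have hνA : ENNReal.ofReal ν ≤ volume A := by
    rw [← ENNReal.ofReal_toReal (volume_coneSublevel_ne_top u 0)]
    exact ENNReal.ofReal_le_ofReal (hνu u M hu hpos)
  have hAb : volume A ≤ b := measure_mono fun x hx => ball_subset_ball (by norm_num) hx.1
  set φ : Rn n → ℝ := fun x => max (5 * (3 - ‖x‖) - max (u x) 0) 0 with hφ
  have hφm : Measurable φ := by fun_prop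
  have hadm : AdmissibleTest n u φ := by
    refine admissibleTest_truncation (V := fun x => 5 * (3 - ‖x‖)) (G := fun t => t) (c := 5)
      (L := 1) (N := 15) hum (by fun_prop) measurable_id (by norm_num) (by norm_num)
      (abs_cone_sub_le (by norm_num) 3) ?_ ?_ (fun _ h => h) (fun a b _ _ => by simp)
    · intro x; linarith [norm_nonneg x]
    · intro x hx
      have : 3 ≤ ‖x‖ := by simpa using hx
      linarith
  have hu3 : ∀ x ∈ ball (0 : Rn n) 3, 0 ≤ u x := fun x hx =>
    hu.nonneg x (ball_subset_ball (by norm_num) hx)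
  have hupper : alignedEnergy n s p u φ ≤ C₂ * (ENNReal.ofReal Q * b) := by
    refine (hC₂ u φ (fun _ => Q) (ball 0 3) hum measurableSet_ball hu.nonneg hu.tail_le
      subset_rfl hadm.eq_zero hadm.nonneg ?_ ?_).trans ?_
    · intro x hx
      have hux := hu3 x hx
      have h6 : (0 : ℝ) < 5 ^ p := by positivity
      rcases (hadm.nonneg x).eq_or_lt with h0 | h0
      · rw [← h0, zero_mul]; positivity
      have hlt : u x < 15 := by
        by_contra! hge
        have : φ x = 0 := max_eq_right (by linarith [norm_nonneg x, le_max_left (u x) 0])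
        linarith
      have h4 : φ x ≤ 15 := max_le (by linarith [norm_nonneg x, le_max_right (u x) 0]) (by norm_num)
      have h5 : (1 + u x) ^ (p - 1) ≤ 16 ^ (p - 1) :=
        Real.rpow_le_rpow (by linarith) (by linarith) (by linarith)
      have h7 : φ x * (1 + u x) ^ (p - 1) ≤ 15 * 16 ^ (p - 1) := by
        have : 0 ≤ (1 + u x) ^ (p - 1) := by positivity
        gcongr
      linarith
    · intro x hx y hy huxy hφxy
      have hux := hu3 x hx
      have huy := hu.nonneg y hy
      have hcone := (abs_le.1 (abs_cone_sub_le (n := n) (c := 5) (by norm_num) 3 x y)).2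
      have h0 : 0 < φ x := (hadm.nonneg y).trans_lt hφxy
      have h1 : φ x = 5 * (3 - ‖x‖) - u x := by
        simp only [hφ, max_eq_left hux] at h0 ⊢
        rcases lt_max_iff.1 h0 with h | h
        · exact max_eq_left h.le
        · exact absurd h (lt_irrefl _)
      have h2 : 5 * (3 - ‖y‖) - u y ≤ φ y := by
        simp only [hφ, max_eq_left huy]; exact le_max_left _ _
      have h3 : u x - u y ≤ 5 * ‖x - y‖ := by linarith
      have h4 : φ x - φ y ≤ 5 * ‖x - y‖ := by linarith
      have h5 : (u x - u y) ^ (p - 1) ≤ (5 * ‖x - y‖) ^ (p - 1) :=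
        Real.rpow_le_rpow (by linarith) h3 (by linarith)
      have h6 : 0 ≤ φ x - φ y := by linarith
      have h7 : (0 : ℝ) < 5 * ‖x - y‖ := by linarith
      calc (u x - u y) ^ (p - 1) * (φ x - φ y)
          ≤ (5 * ‖x - y‖) ^ (p - 1) * (5 * ‖x - y‖) := by gcongr
        _ = 5 ^ p * ‖x - y‖ ^ p := by
          rw [← Real.rpow_add_one h7.ne', sub_add_cancel,
            Real.mul_rpow (by norm_num) (norm_nonneg _)]
        _ ≤ Q * ‖x - y‖ ^ p := by
          gcongr
          rw [hQ]
          have : (0 : ℝ) < 15 * 16 ^ (p - 1) := by positivity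
          linarith
    · rw [setLIntegral_const]
  have henergy := (hu.energy_le hadm).trans (mul_le_mul_right hupper _)
  have hpoint : ∀ x ∈ ball (0 : Rn n) 3, ∀ y ∈ A, ENNReal.ofReal ((1 + u x) ^ (p - 1)) ≤
      ENNReal.ofReal (16 ^ (p - 1)) +
      ENNReal.ofReal c * ENNReal.ofReal ((max (u x - u y) 0) ^ (p - 1) *
        max (-φ x - -φ y) 0 / ‖x - y‖ ^ α) := by
    intro x hx y hy
    have hux := hu3 x hx
    have huy := hu3 y (ball_subset_ball (by norm_num) hy.1)
    rcases le_total (u x) 15 with h15 | h15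
    · refine le_add_right (ENNReal.ofReal_le_ofReal ?_)
      exact Real.rpow_le_rpow (by linarith) (by linarith) (by linarith)
    refine le_add_left ?_
    rw [← ENNReal.ofReal_mul (by positivity)]
    refine ENNReal.ofReal_le_ofReal ?_
    have hx3 : ‖x‖ < 3 := by simpa using hx
    have hy2 : ‖y‖ < 2 := by simpa using hy.1
    have hy4 := hy.2
    have hφx : φ x = 0 := max_eq_right (by linarith [norm_nonneg x, le_max_left (u x) 0])
    have hφy : 5 ≤ φ y := by
      have : 5 * (3 - ‖y‖) - u y ≤ φ y := by
        simp only [hφ, max_eq_left huy]; exact le_max_left _ _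
      linarith
    have hxy : ‖x - y‖ ≤ 10 := by linarith [norm_sub_le x y]
    have hxy0 : 0 < ‖x - y‖ := by
      refine norm_pos_iff.2 (sub_ne_zero.2 ?_)
      rintro rfl
      linarith [norm_nonneg x]
    have hdiff : 1 + u x ≤ 4 * (u x - u y) := by linarith [norm_nonneg y]
    have hsub : 0 ≤ u x - u y := by linarith
    rw [hφx, neg_zero, zero_sub, neg_neg, max_eq_left (by linarith : 0 ≤ φ y), max_eq_left hsub]
    have hk : 10 ^ α / ‖x - y‖ ^ α ≥ 1 := by
      rw [ge_iff_le, one_le_div (by positivity)]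
      gcongr
    calc (1 + u x) ^ (p - 1) ≤ (4 * (u x - u y)) ^ (p - 1) :=
          Real.rpow_le_rpow (by linarith) hdiff (by linarith)
      _ = 4 ^ (p - 1) * (u x - u y) ^ (p - 1) * 1 * 1 := by
          rw [Real.mul_rpow (by norm_num) hsub]; ring
      _ ≤ 4 ^ (p - 1) * (u x - u y) ^ (p - 1) * (φ y / 5) * (10 ^ α / ‖x - y‖ ^ α) := by
          have : 1 ≤ φ y / 5 := by linarith
          gcongr
      _ = c * ((u x - u y) ^ (p - 1) * φ y / ‖x - y‖ ^ α) := by rw [hc]; ring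
  calc (∫⁻ x in ball (0 : Rn n) 3, ENNReal.ofReal ((1 + u x) ^ (p - 1))) * ENNReal.ofReal ν
      ≤ (∫⁻ x in ball (0 : Rn n) 3, ENNReal.ofReal ((1 + u x) ^ (p - 1))) * volume A := by gcongr
    _ = ∫⁻ x in ball (0 : Rn n) 3, ∫⁻ y in A, ENNReal.ofReal ((1 + u x) ^ (p - 1)) := by
        simp only [setLIntegral_const]
        rw [lintegral_mul_const _ (by fun_prop)]
    _ ≤ ∫⁻ x in ball (0 : Rn n) 3, (ENNReal.ofReal (16 ^ (p - 1)) * b +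
          ENNReal.ofReal c * ∫⁻ y, ENNReal.ofReal ((max (u x - u y) 0) ^ (p - 1) *
        max (-φ x - -φ y) 0 / ‖x - y‖ ^ α)) := by
        refine setLIntegral_mono' measurableSet_ball fun x hx => ?_
        refine (setLIntegral_mono' hAm (hpoint x hx)).trans ?_
        rw [lintegral_add_left measurable_const, setLIntegral_const,
          lintegral_const_mul _ (by fun_prop)]
        gcongr
        exact Measure.restrict_le_self
    _ ≤ ENNReal.ofReal (16 ^ (p - 1)) * b * b + ENNReal.ofReal c *
          alignedEnergy n s p u (fun x => -φ x) := by
        rw [lintegral_add_left measurable_const, setLIntegral_const,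
          lintegral_const_mul' _ _ ENNReal.ofReal_ne_top]
        gcongr
        exact setLIntegral_le_lintegral _ _
    _ ≤ _ := by gcongr

lemma rpow_sub_rpow_le_mul {a b q : ℝ} (hb : 0 ≤ b) (hab : b ≤ a) (hq : 1 ≤ q) :
    a ^ q - b ^ q ≤ q * a ^ (q - 1) * (a - b) := by
  rcases (hb.trans hab).eq_or_lt with h0 | h0
  · obtain rfl : b = a := le_antisymm hab (by linarith)
    simp
  have h1 := one_add_mul_self_le_rpow_one_add (s := b / a - 1) (p := q)
    (by linarith [div_nonneg hb h0.le]) hq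
  rw [add_sub_cancel, Real.div_rpow hb h0.le, le_div_iff₀ (by positivity)] at h1
  have h2 : a ^ q = a ^ (q - 1) * a := by rw [← Real.rpow_add_one h0.ne', sub_add_cancel]
  have h3 : (1 + q * (b / a - 1)) * a ^ q = a ^ q - q * a ^ (q - 1) * (a - b) := by
    rw [h2]; field_simp; ring
  linarith

lemma abs_rpow_sub_rpow_le {a b q : ℝ} (ha : 0 ≤ a) (ha1 : a ≤ 1) (hb : 0 ≤ b) (hb1 : b ≤ 1)
    (hq : 1 ≤ q) : |a ^ q - b ^ q| ≤ q * |a - b| := by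
  wlog hab : b ≤ a generalizing a b
  · rw [abs_sub_comm, abs_sub_comm a]
    exact this hb hb1 ha ha1 (le_of_not_ge hab)
  rw [abs_of_nonneg (sub_nonneg.2 hab),
    abs_of_nonneg (sub_nonneg.2 (Real.rpow_le_rpow hb hab (by linarith)))]
  refine (rpow_sub_rpow_le_mul hb hab hq).trans ?_
  have h1 : a ^ (q - 1) ≤ 1 := Real.rpow_le_one ha ha1 (by linarith)
  have h2 : 0 ≤ a - b := sub_nonneg.2 hab
  calc q * a ^ (q - 1) * (a - b) ≤ q * 1 * (a - b) := by gcongr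
    _ = _ := by ring

lemma rpow_neg_sub_rpow_neg_le {a b ε : ℝ} (hb : 1 ≤ b) (hab : b ≤ a) (hε : 0 ≤ ε) :
    b ^ (-ε) - a ^ (-ε) ≤ ε * (a - b) := by
  have hb0 : 0 < b := by linarith
  have ha0 : 0 < a := by linarith
  have h1 : a ^ (-ε) = b ^ (-ε) * (a / b) ^ (-ε) := by
    rw [← Real.mul_rpow hb0.le (by positivity), mul_div_cancel₀ _ hb0.ne']
  have h2 : 1 - ε * (a / b - 1) ≤ (a / b) ^ (-ε) := by
    rw [Real.rpow_def_of_pos (by positivity)]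
    have h3 := Real.add_one_le_exp (Real.log (a / b) * -ε)
    have h4 := Real.log_le_sub_one_of_pos (div_pos ha0 hb0)
    nlinarith
  have h3 : b ^ (-ε) ≤ 1 := Real.rpow_le_one_of_one_le_of_nonpos hb (by linarith)
  have h4 : a / b - 1 ≤ a - b := by
    rw [div_sub_one hb0.ne']
    exact div_le_self (by linarith) hb
  have h5 : 0 ≤ a / b - 1 := by
    rw [div_sub_one hb0.ne']
    exact div_nonneg (by linarith) hb0.le
  have h6 : 0 < b ^ (-ε) := by positivity
  calc b ^ (-ε) - a ^ (-ε) = b ^ (-ε) * (1 - (a / b) ^ (-ε)) := by rw [h1]; ring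
    _ ≤ b ^ (-ε) * (ε * (a / b - 1)) := by gcongr; linarith
    _ ≤ 1 * (ε * (a - b)) := by gcongr
    _ = _ := one_mul _

lemma abs_rpow_neg_sub_rpow_neg_le {a b ε : ℝ} (ha : 1 ≤ a) (hb : 1 ≤ b) (hε : 0 ≤ ε) :
    |a ^ (-ε) - b ^ (-ε)| ≤ ε * |a - b| := by
  wlog hab : b ≤ a generalizing a b
  · rw [abs_sub_comm, abs_sub_comm a]
    exact this hb ha (le_of_not_ge hab)
  have h := Real.rpow_le_rpow_of_nonpos (by linarith) hab (by linarith : -ε ≤ 0)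
  rw [abs_sub_comm, abs_of_nonneg (sub_nonneg.2 h), abs_of_nonneg (sub_nonneg.2 hab)]
  exact rpow_neg_sub_rpow_neg_le hb hab hε

lemma mul_rpow_neg_le_rpow_neg_sub {a b ε : ℝ} (hb : 0 < b) (hab : b ≤ a) (hε : 0 ≤ ε) :
    ε * (a - b) * a ^ (-(1 + ε)) ≤ b ^ (-ε) - a ^ (-ε) := by
  have ha0 : 0 < a := by linarith
  have h1 : b ^ (-ε) = a ^ (-ε) * (b / a) ^ (-ε) := by
    rw [← Real.mul_rpow ha0.le (by positivity), mul_div_cancel₀ _ ha0.ne']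
  have h2 : 1 + ε * (1 - b / a) ≤ (b / a) ^ (-ε) := by
    rw [Real.rpow_def_of_pos (by positivity)]
    have h3 := Real.add_one_le_exp (Real.log (b / a) * -ε)
    have h4 := Real.log_le_sub_one_of_pos (div_pos hb ha0)
    nlinarith
  have h6 : 0 < a ^ (-ε) := by positivity
  have h7 : a ^ (-(1 + ε)) = a ^ (-ε) / a := by
    rw [← Real.rpow_sub_one ha0.ne']
    congr 1; ring
  calc ε * (a - b) * a ^ (-(1 + ε)) = a ^ (-ε) * (ε * (1 - b / a)) := by
        rw [h7]; field_simp
    _ ≤ a ^ (-ε) * ((b / a) ^ (-ε) - 1) := by gcongr; linarith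
    _ = _ := by rw [h1]; ring

/-- The cutoff equal to one on `B₂` and vanishing outside `B₃`. -/
def unitCutoff (n : ℕ) (x : Rn n) : ℝ := max (min 1 (3 - ‖x‖)) 0

lemma unitCutoff_nonneg {n : ℕ} (x : Rn n) : 0 ≤ unitCutoff n x := le_max_right _ _

lemma unitCutoff_le_one {n : ℕ} (x : Rn n) : unitCutoff n x ≤ 1 :=
  max_le (min_le_left _ _) zero_le_one

lemma unitCutoff_eq_one {n : ℕ} {x : Rn n} (hx : x ∈ ball 0 2) : unitCutoff n x = 1 := by
  have : ‖x‖ < 2 := by simpa using hx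
  rw [unitCutoff, min_eq_left (by linarith), max_eq_left zero_le_one]

lemma unitCutoff_eq_zero {n : ℕ} {x : Rn n} (hx : x ∉ ball 0 3) : unitCutoff n x = 0 := by
  have : 3 ≤ ‖x‖ := by simpa using hx
  exact max_eq_right ((min_le_right _ _).trans (by linarith))

lemma unitCutoff_pos {n : ℕ} {x : Rn n} (hx : x ∈ ball 0 3) : 0 < unitCutoff n x := by
  have : ‖x‖ < 3 := by simpa using hx
  exact lt_max_of_lt_left (lt_min one_pos (by linarith))

lemma abs_unitCutoff_sub_le {n : ℕ} (x y : Rn n) :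
    |unitCutoff n x - unitCutoff n y| ≤ ‖x - y‖ := by
  refine (abs_max_zero_sub_max_zero_le _ _).trans ((abs_min_sub_min_le_max _ _ _ _).trans ?_)
  rw [sub_self, abs_zero, sub_sub_sub_cancel_left, norm_sub_rev x y]
  exact max_le (norm_nonneg _) (abs_norm_sub_norm_le y x)

lemma measurable_unitCutoff (n : ℕ) : Measurable (unitCutoff n) := by
  unfold unitCutoff; fun_prop

/-- The test function `(η (1 + u₊)^{-γ})^p`. -/
def powerTest (n : ℕ) (p γ : ℝ) (u : Rn n → ℝ) (x : Rn n) : ℝ :=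
  (unitCutoff n x * (1 + max (u x) 0) ^ (-γ)) ^ p

lemma powerTest_base_nonneg {n : ℕ} (γ : ℝ) (u : Rn n → ℝ) (x : Rn n) :
    0 ≤ unitCutoff n x * (1 + max (u x) 0) ^ (-γ) :=
  mul_nonneg (unitCutoff_nonneg x) (by positivity)

lemma powerTest_base_le_one {n : ℕ} {γ : ℝ} (hγ : 0 ≤ γ) (u : Rn n → ℝ) (x : Rn n) :
    unitCutoff n x * (1 + max (u x) 0) ^ (-γ) ≤ 1 :=
  mul_le_one₀ (unitCutoff_le_one x) (by positivity)
    (Real.rpow_le_one_of_one_le_of_nonpos (by linarith [le_max_right (u x) 0]) (by linarith))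

lemma admissibleTest_powerTest {n : ℕ} {p γ : ℝ} {u : Rn n → ℝ} (hp : 1 ≤ p) (hγ : 0 ≤ γ)
    (hγ1 : γ ≤ 1) (hu : Measurable u) : AdmissibleTest n u (powerTest n p γ u) where
  measurable := by
    have := measurable_unitCutoff n
    unfold powerTest; fun_prop
  nonneg x := Real.rpow_nonneg (powerTest_base_nonneg γ u x) _
  bdd := ⟨1, fun x => Real.rpow_le_one (powerTest_base_nonneg γ u x)
    (powerTest_base_le_one hγ u x) (by linarith)⟩
  eq_zero x hx := by
    rw [powerTest, unitCutoff_eq_zero hx, zero_mul, Real.zero_rpow (by linarith)]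
  lip := by
    refine ⟨p, by linarith, fun x y => ?_⟩
    refine (abs_rpow_sub_rpow_le (powerTest_base_nonneg γ u x) (powerTest_base_le_one hγ u x)
      (powerTest_base_nonneg γ u y) (powerTest_base_le_one hγ u y) hp).trans ?_
    have hx1 : 1 ≤ 1 + max (u x) 0 := by linarith [le_max_right (u x) 0]
    have hy1 : 1 ≤ 1 + max (u y) 0 := by linarith [le_max_right (u y) 0]
    have h1 := abs_rpow_neg_sub_rpow_neg_le hx1 hy1 hγ
    rw [add_sub_add_left_eq_sub] at h1
    have h2 := abs_max_zero_sub_max_zero_le (u x) (u y)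
    have h3 := abs_unitCutoff_sub_le x y
    have h4 : (1 + max (u y) 0) ^ (-γ) ≤ 1 :=
      Real.rpow_le_one_of_one_le_of_nonpos hy1 (by linarith)
    have h5 : 0 ≤ (1 + max (u y) 0) ^ (-γ) := by positivity
    gcongr
    calc |unitCutoff n x * (1 + max (u x) 0) ^ (-γ) - unitCutoff n y * (1 + max (u y) 0) ^ (-γ)|
        = |unitCutoff n x * ((1 + max (u x) 0) ^ (-γ) - (1 + max (u y) 0) ^ (-γ)) +
            (unitCutoff n x - unitCutoff n y) * (1 + max (u y) 0) ^ (-γ)| := by congr 1; ring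
      _ ≤ |unitCutoff n x * ((1 + max (u x) 0) ^ (-γ) - (1 + max (u y) 0) ^ (-γ))| +
            |(unitCutoff n x - unitCutoff n y) * (1 + max (u y) 0) ^ (-γ)| := abs_add_le _ _
      _ ≤ 1 * (1 * |u x - u y|) + ‖x - y‖ * 1 := by
        rw [abs_mul, abs_mul, abs_of_nonneg (unitCutoff_nonneg x), abs_of_nonneg h5]
        have := unitCutoff_le_one x
        gcongr
        exact h1.trans (by gcongr)
      _ = _ := by ring

lemma powerTest_difference_le {n : ℕ} {p γ : ℝ} {u : Rn n → ℝ} (hp : 1 ≤ p) (hγ : 0 < γ)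
    (hγ1 : γ ≤ 1) {x y : Rn n} (hx : x ∈ ball 0 3) (hux : 0 ≤ u x) (huy : 0 ≤ u y)
    (huxy : u y < u x) (hφ : powerTest n p γ u y < powerTest n p γ u x) :
    (u x - u y) ^ (p - 1) * (powerTest n p γ u x - powerTest n p γ u y) ≤
      p * γ ^ (1 - p) * (1 + u x) ^ (p - 1) * ‖x - y‖ ^ p := by
  have hηx := unitCutoff_pos hx
  set η := unitCutoff n x with hη
  set κ := unitCutoff n y with hκ
  have hκ0 : 0 ≤ κ := unitCutoff_nonneg y
  set a := 1 + u x with ha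
  set b := 1 + u y with hb
  have ha0 : 0 < a := by linarith
  have hb0 : 0 < b := by linarith
  have hφx : powerTest n p γ u x = (η * a ^ (-γ)) ^ p := by rw [powerTest, max_eq_left hux]
  have hφy : powerTest n p γ u y = (κ * b ^ (-γ)) ^ p := by rw [powerTest, max_eq_left huy]
  rw [hφx, hφy] at hφ ⊢
  have hθ : κ * b ^ (-γ) < η * a ^ (-γ) :=
    lt_of_not_ge fun h => absurd hφ (not_lt.2 (Real.rpow_le_rpow (by positivity) h (by linarith)))
  have hab : a ^ (-γ) ≤ b ^ (-γ) :=
    Real.rpow_le_rpow_of_nonpos hb0 (by linarith) (by linarith)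
  have haγ : 0 < a ^ (-γ) := by positivity
  have hκη : κ < η := by
    by_contra! h
    have : η * a ^ (-γ) ≤ κ * b ^ (-γ) := by gcongr
    linarith
  have hηκ : η - κ ≤ ‖x - y‖ := (le_abs_self _).trans (abs_unitCutoff_sub_le x y)
  have hN : 0 < ‖x - y‖ := by linarith
  -- the ratio of the two values of `u`
  have hr : κ ≤ η * (b / a) ^ γ := by
    rw [Real.div_rpow hb0.le ha0.le]
    rw [Real.rpow_neg hb0.le, Real.rpow_neg ha0.le] at hθ
    have hbγ : 0 < b ^ γ := by positivity
    have haγ' : 0 < a ^ γ := by positivity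
    rw [← div_eq_mul_inv, ← div_eq_mul_inv, div_lt_div_iff₀ hbγ haγ'] at hθ
    rw [← mul_div_assoc, le_div_iff₀ haγ']
    exact hθ.le
  have hbern : (b / a) ^ γ ≤ 1 + γ * (b / a - 1) := by
    have := rpow_one_add_le_one_add_mul_self (s := b / a - 1) (p := γ)
      (by linarith [div_pos hb0 ha0]) hγ.le hγ1
    rwa [add_sub_cancel] at this
  have hu1 : u x - u y ≤ a * (γ⁻¹ * (‖x - y‖ / η)) := by
    have h1 : γ * (1 - b / a) ≤ ‖x - y‖ / η := by
      rw [le_div_iff₀ hηx]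
      nlinarith
    have h2 : 1 - b / a ≤ γ⁻¹ * (‖x - y‖ / η) := by
      rw [inv_mul_eq_div, le_div_iff₀ hγ]; linarith
    calc u x - u y = a * (1 - b / a) := by rw [mul_sub, mul_div_cancel₀ _ ha0.ne']; linarith
      _ ≤ _ := by gcongr
  have hφ1 : (η * a ^ (-γ)) ^ p - (κ * b ^ (-γ)) ^ p ≤ p * η ^ (p - 1) * ‖x - y‖ := by
    have h1 : (κ * a ^ (-γ)) ^ p ≤ (κ * b ^ (-γ)) ^ p := by gcongr
    have h2 : (a ^ (-γ)) ^ p ≤ 1 := Real.rpow_le_one haγ.le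
      (Real.rpow_le_one_of_one_le_of_nonpos (by linarith) (by linarith)) (by linarith)
    have h3 := rpow_sub_rpow_le_mul hκ0 hκη.le hp
    have h4 : 0 ≤ η ^ p - κ ^ p := sub_nonneg.2 (Real.rpow_le_rpow hκ0 hκη.le (by linarith))
    calc (η * a ^ (-γ)) ^ p - (κ * b ^ (-γ)) ^ p ≤ (η * a ^ (-γ)) ^ p - (κ * a ^ (-γ)) ^ p := by
          linarith
      _ = (η ^ p - κ ^ p) * (a ^ (-γ)) ^ p := by
          rw [Real.mul_rpow hηx.le haγ.le, Real.mul_rpow hκ0 haγ.le]; ring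
      _ ≤ (η ^ p - κ ^ p) * 1 := by gcongr
      _ ≤ p * η ^ (p - 1) * (η - κ) := by linarith
      _ ≤ _ := by gcongr
  have hd : 0 ≤ (η * a ^ (-γ)) ^ p - (κ * b ^ (-γ)) ^ p := by linarith
  have hp1 : 0 ≤ p - 1 := by linarith
  calc (u x - u y) ^ (p - 1) * ((η * a ^ (-γ)) ^ p - (κ * b ^ (-γ)) ^ p)
      ≤ (a * (γ⁻¹ * (‖x - y‖ / η))) ^ (p - 1) * (p * η ^ (p - 1) * ‖x - y‖) := by
        have : 0 ≤ u x - u y := by linarith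
        gcongr
    _ = p * γ ^ (1 - p) * a ^ (p - 1) * (‖x - y‖ ^ (p - 1) * ‖x - y‖) := by
        rw [Real.mul_rpow ha0.le (by positivity), Real.mul_rpow (by positivity) (by positivity),
          Real.div_rpow hN.le hηx.le, Real.inv_rpow hγ.le, ← Real.rpow_neg hγ.le, neg_sub]
        field_simp
    _ = _ := by rw [← Real.rpow_add_one hN.ne', sub_add_cancel]

lemma volumeRadius_le_half {n : ℕ} (hn : 1 ≤ n) {a : ℝ} (ha : 0 ≤ a)
    (h : a ≤ (volume (ball (0 : Rn n) 1)).toReal * (1 / 2) ^ n) : volumeRadius n a ≤ 1 / 2 := by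
  have hω := toReal_volume_unitBall_pos n
  calc volumeRadius n a ≤ ((1 / 2 : ℝ) ^ n) ^ (1 / (n : ℝ)) := by
        refine Real.rpow_le_rpow (by positivity) ?_ (by positivity)
        rwa [div_le_iff₀ hω, mul_comm]
    _ = 1 / 2 := by
        rw [one_div (n : ℝ)]
        exact Real.pow_rpow_inv_natCast (by norm_num) (by omega)

lemma exists_rpow_le_lintegral_powerTest {n : ℕ} {s p k : ℝ} (hn : 1 ≤ n) (hs : 0 < s)
    (hp : 1 < p) (hk : 0 < k) :
    ∃ D E : ℝ, 0 ≤ D ∧ 0 ≤ E ∧ ∀ u : Rn n → ℝ, Measurable u → (∀ x ∈ ball 0 4, 0 ≤ u x) →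
      ∫⁻ x in ball (0 : Rn n) 3, ENNReal.ofReal ((1 + u x) ^ (p - 1)) ≤ ENNReal.ofReal k →
      ∀ x ∈ ball (0 : Rn n) (3 / 2),
        ENNReal.ofReal ((1 + u x) ^ ((1 + (p - 1) * s / n) * (p - 1))) ≤ ENNReal.ofReal D +
          ENNReal.ofReal E * ∫⁻ y, ENNReal.ofReal ((max (u x - u y) 0) ^ (p - 1) *
            max (-powerTest n p ((p - 1) * s / n / p) u x -
              -powerTest n p ((p - 1) * s / n / p) u y) 0 / ‖x - y‖ ^ ((n : ℝ) + s * p)) := by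
  have hp0 : 0 < p := by linarith
  have hp1 : 0 < p - 1 := by linarith
  have hn0 : (0 : ℝ) < n := by exact_mod_cast hn
  set ε := (p - 1) * s / n with hε
  have hε0 : 0 < ε := by positivity
  set α := (n : ℝ) + s * p with hα
  have hα0 : 0 < α := by positivity
  set ω := (volume (ball (0 : Rn n) 1)).toReal with hω
  have hω0 : 0 < ω := toReal_volume_unitBall_pos n
  set e := (1 + ε) * (p - 1) with he
  have he0 : 0 < e := by positivity
  have h2ε : (2 : ℝ) ^ (-ε) < 1 := Real.rpow_lt_one_of_one_lt_of_neg (by norm_num) (by linarith)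
  set c := (1 - 2 ^ (-ε)) * ω ^ (α / n) * 2 ^ (-(α / n)) * k ^ (-(s * p / n)) with hc
  have hc0 : 0 < c := by
    have : 0 < 1 - (2 : ℝ) ^ (-ε) := by linarith
    positivity
  refine ⟨2 ^ e * (2 * k / (ω * (1 / 2) ^ n)) ^ (1 + ε), 2 ^ e / c, by positivity, by positivity,
    fun u hum hu0 hk' x hx => ?_⟩
  have hx32 : ‖x‖ < 3 / 2 := by simpa using hx
  have hux : 0 ≤ u x := hu0 x (ball_subset_ball (by norm_num) hx)
  set v := (1 + u x) / 2 with hv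
  have hv0 : 0 < v := by positivity
  have hwv : 1 + u x = 2 * v := by rw [hv]; ring
  have hwe : (1 + u x) ^ e = 2 ^ e * v ^ e := by rw [hwv, Real.mul_rpow (by norm_num) hv0.le]
  set a := k * v ^ (-(p - 1)) with ha
  have ha0 : 0 < a := by positivity
  rcases lt_or_ge (ω * (1 / 2) ^ n) (2 * a) with hbig | hsmall
  · refine le_add_right (ENNReal.ofReal_le_ofReal ?_)
    rw [hwe, he, mul_comm (1 + ε), Real.rpow_mul hv0.le]
    have h1 : v ^ (p - 1) ≤ 2 * k / (ω * (1 / 2) ^ n) := by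
      rw [le_div_iff₀ (by positivity)]
      have h2 : v ^ (p - 1) * v ^ (-(p - 1)) = 1 := by
        rw [← Real.rpow_add hv0, add_neg_cancel, Real.rpow_zero]
      calc v ^ (p - 1) * (ω * (1 / 2) ^ n) ≤ v ^ (p - 1) * (2 * a) := by gcongr
        _ = 2 * k * (v ^ (p - 1) * v ^ (-(p - 1))) := by rw [ha]; ring
        _ = 2 * k := by rw [h2, mul_one]
    gcongr
  refine le_add_left ?_
  set ρ := volumeRadius n (2 * a) with hρ
  have hρ0 : 0 < ρ := volumeRadius_pos (by positivity)
  have hρ1 : ρ ≤ 1 / 2 := volumeRadius_le_half hn (by positivity) hsmall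
  set A := {y | v < 1 + u y} ∩ ball (0 : Rn n) 3 with hA
  have hAm : MeasurableSet A := (measurableSet_lt measurable_const (by fun_prop)).inter
    measurableSet_ball
  have hAa : volume A ≤ ENNReal.ofReal a := by
    have h1 : ENNReal.ofReal (v ^ (p - 1)) * volume A ≤ ENNReal.ofReal k := by
      rw [← setLIntegral_const]
      refine (setLIntegral_mono' hAm fun y hy => ENNReal.ofReal_le_ofReal ?_).trans
        ((lintegral_mono_set inter_subset_right).trans hk')
      exact Real.rpow_le_rpow hv0.le (le_of_lt hy.1) hp1.le
    rw [ha, Real.rpow_neg hv0.le, ← div_eq_mul_inv, ENNReal.ofReal_div_of_pos (by positivity)]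
    rw [ENNReal.le_div_iff_mul_le (Or.inl (ENNReal.ofReal_pos.2 (by positivity)).ne')
      (Or.inl ENNReal.ofReal_ne_top), mul_comm]
    exact h1
  set F : Rn n → ℝ := fun y => (max (u x - u y) 0) ^ (p - 1) *
      max (-powerTest n p (ε / p) u x - -powerTest n p (ε / p) u y) 0 / ‖x - y‖ ^ α with hF
  set q := v ^ (p - 1) * (v ^ (-ε) * (1 - 2 ^ (-ε))) / ρ ^ α with hq
  have hq0 : 0 < q := by
    have : 0 < 1 - (2 : ℝ) ^ (-ε) := by linarith
    positivity
  have hpt : ∀ z ∈ ball (0 : Rn n) 2, 0 ≤ u z →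
      powerTest n p (ε / p) u z = (1 + u z) ^ (-ε) := by
    intro z hz huz
    rw [powerTest, unitCutoff_eq_one hz, one_mul, max_eq_left huz, ← Real.rpow_mul (by linarith)]
    congr 1; field_simp
  have hpoint : ∀ y ∈ ball x ρ \ A, q ≤ F y := by
    intro y hy
    have hxy : ‖x - y‖ < ρ := by simpa [dist_eq_norm, norm_sub_rev] using hy.1
    have hy2 : y ∈ ball (0 : Rn n) 2 := by
      rw [mem_ball, dist_zero_right]
      have := norm_sub_norm_le y x
      rw [norm_sub_rev] at this
      linarith
    have huy : 0 ≤ u y := hu0 y (ball_subset_ball (by norm_num) hy2)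
    have hyv : 1 + u y ≤ v := by
      by_contra! h
      exact hy.2 ⟨h, ball_subset_ball (by norm_num) hy2⟩
    have hxy0 : 0 < ‖x - y‖ := by
      refine norm_pos_iff.2 (sub_ne_zero.2 ?_)
      rintro rfl
      linarith
    have h1 : v ≤ max (u x - u y) 0 := le_max_of_le_left (by linarith)
    have h2 : v ^ (-ε) * (1 - 2 ^ (-ε)) ≤
        max (-powerTest n p (ε / p) u x - -powerTest n p (ε / p) u y) 0 := by
      refine le_max_of_le_left ?_
      rw [hpt y hy2 huy, hpt x (ball_subset_ball (by norm_num) hx) hux, hwv,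
        Real.mul_rpow (by norm_num) hv0.le]
      have : v ^ (-ε) ≤ (1 + u y) ^ (-ε) :=
        Real.rpow_le_rpow_of_nonpos (by linarith) hyv (by linarith)
      linarith
    have h3 : 0 ≤ v ^ (-ε) * (1 - 2 ^ (-ε)) := mul_nonneg (by positivity) (by linarith)
    simp only [hq, hF]
    gcongr
  have hqa : q * a = c * v ^ e := by
    have h1 : ρ ^ α = ω ^ (-(α / n)) * (2 ^ (α / n) * a ^ (α / n)) := by
      rw [hρ, volumeRadius_rpow (by positivity), Real.mul_rpow (by norm_num) ha0.le]
    have h2 : a / a ^ (α / n) = k ^ (-(s * p / n)) * v ^ (ε * p) := by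
      have h3 : a / a ^ (α / n) = a ^ (1 - α / n) := by
        rw [Real.rpow_sub ha0, Real.rpow_one]
      rw [h3, show 1 - α / n = -(s * p / n) by rw [hα]; field_simp; ring, ha,
        Real.mul_rpow hk.le (by positivity), ← Real.rpow_mul hv0.le]
      congr 2; rw [hε]; ring
    have h3 : v ^ e = v ^ (p - 1) * v ^ (-ε) * v ^ (ε * p) := by
      rw [← Real.rpow_add hv0, ← Real.rpow_add hv0]; congr 1; rw [he]; ring
    calc q * a = v ^ (p - 1) * (v ^ (-ε) * (1 - 2 ^ (-ε))) * (ω ^ (α / n) * (2 : ℝ) ^ (-(α / n))) *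
          (a / a ^ (α / n)) := by
          rw [hq, h1, Real.rpow_neg hω0.le, Real.rpow_neg (by norm_num : (0 : ℝ) ≤ 2) (α / n)]
          field_simp
      _ = _ := by rw [h2, h3, hc]; ring
  calc ENNReal.ofReal ((1 + u x) ^ e) = ENNReal.ofReal (2 ^ e / c) * ENNReal.ofReal (q * a) := by
        rw [← ENNReal.ofReal_mul (by positivity), hqa, hwe]
        congr 1; field_simp
    _ ≤ ENNReal.ofReal (2 ^ e / c) * ∫⁻ y in ball x ρ \ A, ENNReal.ofReal q := by
        rw [setLIntegral_const, ENNReal.ofReal_mul hq0.le]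
        gcongr
        exact le_volume_ball_volumeRadius_diff hn ha0 x hAa
    _ ≤ ENNReal.ofReal (2 ^ e / c) * ∫⁻ y, ENNReal.ofReal (F y) := by
        refine mul_le_mul_right ?_ _
        refine (setLIntegral_mono' (measurableSet_ball.diff hAm) fun y hy =>
          ENNReal.ofReal_le_ofReal (hpoint y hy)).trans (setLIntegral_le_lintegral _ _)

lemma exists_lintegral_one_add_rpow_gain_le {n : ℕ} {s p : ℝ} (hn : 1 ≤ n) (hs : 0 < s)
    (hs1 : s < 1) (hp : 1 < p) (C₀ : ℝ≥0) :
    ∃ C : ℝ≥0, ∀ (u : Rn n → ℝ) (M : ℝ), UnitSupersolution n s p C₀ M u →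
      volume ({x | u x < 1} ∩ ball 0 1) ≠ 0 →
      ∫⁻ x in ball (0 : Rn n) (3 / 2),
        ENNReal.ofReal ((1 + u x) ^ ((1 + (p - 1) * s / n) * (p - 1))) ≤ C := by
  obtain ⟨C₁, hC₁⟩ := exists_lintegral_one_add_rpow_le hn hs hs1 hp C₀
  obtain ⟨C₂, hC₂⟩ := exists_alignedEnergy_le hn hs hs1 hp
  obtain ⟨D, E, hD, hE, hDE⟩ := exists_rpow_le_lintegral_powerTest (n := n) (s := s) (p := p)
    (k := C₁ + 1) hn hs hp (by positivity)
  have hn0 : (0 : ℝ) < n := by exact_mod_cast hn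
  have hn1 : (1 : ℝ) ≤ n := by exact_mod_cast hn
  set γ := (p - 1) * s / n / p with hγ
  have hp1 : 0 < p - 1 := by linarith
  have hp0 : 0 < p := by linarith
  have hγ0 : 0 < γ := by positivity
  have hγ1 : γ ≤ 1 := by
    rw [hγ, div_div, div_le_one (by positivity)]
    nlinarith
  set Q := p * γ ^ (1 - p) + 1 with hQ
  have hQ1 : 0 ≤ p * γ ^ (1 - p) := by positivity
  have hb : volume (ball (0 : Rn n) (3 / 2)) ≠ ⊤ := measure_ball_lt_top.ne
  set X : ℝ≥0∞ := ENNReal.ofReal D * volume (ball (0 : Rn n) (3 / 2)) +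
    ENNReal.ofReal E * (C₀ * (C₂ * (ENNReal.ofReal Q * C₁))) with hX
  have hXtop : X ≠ ⊤ := by
    rw [hX, ENNReal.add_ne_top]; constructor <;> finiteness
  refine ⟨X.toNNReal, fun u M hu hpos => ?_⟩
  rw [ENNReal.coe_toNNReal hXtop]
  have hum := hu.measurable
  have hu3 : ∀ x ∈ ball (0 : Rn n) 3, 0 ≤ u x := fun x hx =>
    hu.nonneg x (ball_subset_ball (by norm_num) hx)
  have hadm : AdmissibleTest n u (powerTest n p γ u) :=
    admissibleTest_powerTest hp.le hγ0.le hγ1 hum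
  have hupper : alignedEnergy n s p u (powerTest n p γ u) ≤ C₂ * (ENNReal.ofReal Q * C₁) := by
    refine (hC₂ u _ (fun x => Q * (1 + u x) ^ (p - 1)) (ball 0 3) hum measurableSet_ball
      hu.nonneg hu.tail_le subset_rfl hadm.eq_zero hadm.nonneg ?_ ?_).trans ?_
    · intro x hx
      have hux := hu3 x hx
      have h1 : powerTest n p γ u x ≤ Q := le_trans (Real.rpow_le_one (powerTest_base_nonneg γ u x)
        (powerTest_base_le_one hγ0.le u x) hp0.le) (by linarith)
      gcongr
    · intro x hx y hy huxy hφ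
      have hux := hu3 x hx
      refine (powerTest_difference_le hp.le hγ0 hγ1 hx hux (hu.nonneg y hy) huxy hφ).trans ?_
      gcongr
      linarith
    · have : ∀ x, ENNReal.ofReal (Q * (1 + u x) ^ (p - 1)) =
          ENNReal.ofReal Q * ENNReal.ofReal ((1 + u x) ^ (p - 1)) := fun x =>
        ENNReal.ofReal_mul (by positivity)
      simp only [this]
      rw [lintegral_const_mul' _ _ ENNReal.ofReal_ne_top]
      gcongr
      exact hC₁ u M hu hpos
  have henergy := (hu.energy_le hadm).trans (mul_le_mul_right hupper _)
  have hk : ∫⁻ x in ball (0 : Rn n) 3, ENNReal.ofReal ((1 + u x) ^ (p - 1)) ≤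
      ENNReal.ofReal (C₁ + 1) := by
    refine (hC₁ u M hu hpos).trans ?_
    rw [← ENNReal.ofReal_coe_nnreal]
    exact ENNReal.ofReal_le_ofReal (by linarith)
  refine (setLIntegral_mono' measurableSet_ball (hDE u hum hu.nonneg hk)).trans ?_
  rw [lintegral_add_left measurable_const, setLIntegral_const,
    lintegral_const_mul' _ _ ENNReal.ofReal_ne_top, hX]
  gcongr
  exact (setLIntegral_le_lintegral _ _).trans henergy

/-- The measure density bound at unit scale. -/
lemma exists_mass_le {n : ℕ} {s p : ℝ} (hn : 1 ≤ n) (hs : 0 < s)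
    (hs1 : s < 1) (hp : 1 < p) (C₀ : ℝ≥0) :
    ∃ C : ℝ≥0, ∀ (u : Rn n → ℝ) (M : ℝ), UnitSupersolution n s p C₀ M u →
      volume ({x | u x < 1} ∩ ball 0 1) ≠ 0 → ENNReal.ofReal M ≤ C := by
  obtain ⟨C₁, hC₁⟩ := exists_lintegral_one_add_rpow_gain_le hn hs hs1 hp C₀
  obtain ⟨C₂, hC₂⟩ := exists_alignedEnergy_le hn hs hs1 hp
  have hn0 : (0 : ℝ) < n := by exact_mod_cast hn
  have hp1 : 0 < p - 1 := by linarith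
  set ε := (p - 1) * s / n with hε
  have hε0 : 0 < ε := by positivity
  set Q : ℝ := 6 + 4 * (4 / ε) ^ (p - 1) with hQ
  have hQ0 : 0 ≤ Q := by positivity
  refine ⟨C₀ * (C₂ * (Q.toNNReal * C₁)), fun u M hu hpos => ?_⟩
  have hum := hu.measurable
  have hu32 : ∀ x ∈ ball (0 : Rn n) (3 / 2), 0 ≤ u x := fun x hx =>
    hu.nonneg x (ball_subset_ball (by norm_num) hx)
  set G : ℝ → ℝ := fun t => 1 - (1 + t) ^ (-ε) with hG
  have hG0 : ∀ t, 0 ≤ t → 0 ≤ G t := fun t ht =>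
    sub_nonneg.2 (Real.rpow_le_one_of_one_le_of_nonpos (by linarith) (by linarith))
  have hG1 : ∀ t, 0 ≤ t → G t ≤ 1 := fun t ht => sub_le_self _ (by positivity)
  set φ : Rn n → ℝ := fun x => max (4 * (3 / 2 - ‖x‖) - G (max (u x) 0)) 0 with hφ
  have hadm : AdmissibleTest n u φ := by
    refine admissibleTest_truncation (V := fun x => 4 * (3 / 2 - ‖x‖)) (G := G) (c := 4)
      (L := ε) (N := 6) hum (by fun_prop) (by fun_prop) (by norm_num) hε0.le
      (abs_cone_sub_le (by norm_num) _) ?_ ?_ hG0 ?_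
    · intro x; linarith [norm_nonneg x]
    · intro x hx
      have : 3 ≤ ‖x‖ := by simpa using hx
      linarith
    · intro a b ha hb
      have := abs_rpow_neg_sub_rpow_neg_le (a := 1 + b) (b := 1 + a) (ε := ε)
        (by linarith) (by linarith) hε0.le
      rw [add_sub_add_left_eq_sub, abs_sub_comm b a] at this
      simpa only [hG, sub_sub_sub_cancel_left] using this
  have hone : ∀ x ∈ ball (0 : Rn n) 1, 1 ≤ φ x := by
    intro x hx
    have : ‖x‖ < 1 := by simpa using hx
    exact le_max_of_le_left (by linarith [hG1 _ (le_max_right (u x) 0)])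
  have hupper : alignedEnergy n s p u φ ≤ C₂ * (Q.toNNReal * C₁) := by
    refine (hC₂ u φ (fun x => Q * (1 + u x) ^ ((1 + ε) * (p - 1))) (ball 0 (3 / 2)) hum
      measurableSet_ball hu.nonneg hu.tail_le (ball_subset_ball (by norm_num)) ?_ hadm.nonneg
      ?_ ?_).trans ?_
    · intro x hx
      have : 3 / 2 ≤ ‖x‖ := by simpa using hx
      exact max_eq_right (by linarith [hG0 _ (le_max_right (u x) 0)])
    · intro x hx
      have hux := hu32 x hx
      have h1 : φ x ≤ 6 :=
        max_le (by linarith [norm_nonneg x, hG0 _ (le_max_right (u x) 0)]) (by norm_num)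
      have h2 : (1 + u x) ^ (p - 1) ≤ (1 + u x) ^ ((1 + ε) * (p - 1)) :=
        Real.rpow_le_rpow_of_exponent_le (by linarith) (by nlinarith)
      have h3 : φ x ≤ Q := h1.trans (le_add_of_nonneg_right (by positivity))
      have h4 : 0 ≤ (1 + u x) ^ (p - 1) := by positivity
      gcongr
    · intro x hx y hy huxy hφxy
      have hux := hu32 x hx
      have huy := hu.nonneg y hy
      have hcone := (abs_le.1 (abs_cone_sub_le (n := n) (c := 4) (by norm_num) (3 / 2) x y)).2
      have h0 : 0 < φ x := (hadm.nonneg y).trans_lt hφxy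
      have h1 : φ x = 4 * (3 / 2 - ‖x‖) - G (u x) := by
        simp only [hφ, max_eq_left hux] at h0 ⊢
        rcases lt_max_iff.1 h0 with h | h
        · exact max_eq_left h.le
        · exact absurd h (lt_irrefl _)
      have h2 : 4 * (3 / 2 - ‖y‖) - G (u y) ≤ φ y := by
        simp only [hφ, max_eq_left huy]; exact le_max_left _ _
      have hGd := mul_rpow_neg_le_rpow_neg_sub (a := 1 + u x) (b := 1 + u y) (ε := ε)
        (by linarith) (by linarith) hε0.le
      have hGd' : G (u x) - G (u y) = (1 + u y) ^ (-ε) - (1 + u x) ^ (-ε) :=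
        sub_sub_sub_cancel_left _ _ _
      rw [add_sub_add_left_eq_sub] at hGd
      have hpos' : 0 < ε * (u x - u y) * (1 + u x) ^ (-(1 + ε)) := by
        have : 0 < u x - u y := by linarith
        positivity
      have h4 : φ x - φ y ≤ 4 * ‖x - y‖ := by linarith
      have h3 : u x - u y ≤ 4 / ε * (1 + u x) ^ (1 + ε) * ‖x - y‖ := by
        have h5 : ε * (u x - u y) * (1 + u x) ^ (-(1 + ε)) ≤ 4 * ‖x - y‖ := by linarith
        rw [Real.rpow_neg (by linarith), ← div_eq_mul_inv, div_le_iff₀ (by positivity)] at h5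
        rw [div_mul_eq_mul_div, div_mul_eq_mul_div, le_div_iff₀ hε0]
        linarith
      have h5 : 0 ≤ u x - u y := by linarith
      have h6 : 0 ≤ φ x - φ y := by linarith
      have h7 : 0 < ‖x - y‖ := by linarith
      calc (u x - u y) ^ (p - 1) * (φ x - φ y)
          ≤ (4 / ε * (1 + u x) ^ (1 + ε) * ‖x - y‖) ^ (p - 1) * (4 * ‖x - y‖) := by gcongr
        _ = 4 * (4 / ε) ^ (p - 1) * (1 + u x) ^ ((1 + ε) * (p - 1)) *
              (‖x - y‖ ^ (p - 1) * ‖x - y‖) := by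
          rw [Real.mul_rpow (by positivity) h7.le, Real.mul_rpow (by positivity) (by positivity),
            ← Real.rpow_mul (by linarith)]
          ring
        _ ≤ Q * (1 + u x) ^ ((1 + ε) * (p - 1)) * ‖x - y‖ ^ p := by
          rw [← Real.rpow_add_one h7.ne', sub_add_cancel]
          gcongr
          rw [hQ]; linarith
    · have : ∀ x, ENNReal.ofReal (Q * (1 + u x) ^ ((1 + ε) * (p - 1))) =
          ENNReal.ofReal Q * ENNReal.ofReal ((1 + u x) ^ ((1 + ε) * (p - 1))) := fun x =>
        ENNReal.ofReal_mul hQ0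
      simp only [this]
      rw [lintegral_const_mul' _ _ ENNReal.ofReal_ne_top]
      gcongr
      · rfl
      · exact hC₁ u M hu hpos
  have h := hu.energy φ hadm 1 zero_le_one hone
  rw [one_mul] at h
  push_cast
  exact (le_self_add.trans h).trans (mul_le_mul_right hupper _)

section Mollification

variable {n : ℕ} {Y : Type*} [NormedAddCommGroup Y] [NormedSpace ℝ Y] [FiniteDimensional ℝ Y]
  [MeasurableSpace Y] [BorelSpace Y] {ν : Measure Y} [ν.IsAddHaarMeasure] {p q : ℝ} {H D : Y → ℝ}
  {ι : Rn n → Y}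

lemma continuous_integral_mul_comp_sub (hpq : q.HolderConjugate p)
    (hH : MemLp H (ENNReal.ofReal q) ν) (hD : MemLp D (ENNReal.ofReal p) ν) (hι : Continuous ι) :
    Continuous fun t => ∫ z, H z * D (z - ι t) ∂ν := by
  have hc : (ENNReal.ofReal q).HolderConjugate (ENNReal.ofReal p) := hpq.ennrealOfReal
  have : Fact (1 ≤ ENNReal.ofReal p) := ⟨by simpa using hpq.symm.lt.le⟩
  have : Fact (1 ≤ ENNReal.ofReal q) := ⟨by simpa using hpq.lt.le⟩
  have := FiniteDimensional.proper ℝ Y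
  let g : Rn n → C(Y, Y) := fun t => ⟨fun z => z - ι t, by fun_prop⟩
  have hg : Continuous g := ContinuousMap.continuous_of_continuous_uncurry _ (by
    change Continuous fun w : Rn n × Y => w.2 - ι w.1
    fun_prop)
  have hgm : ∀ t, MeasurePreserving (g t) ν ν := fun t => measurePreserving_sub_right ν (ι t)
  have h1 := (continuous_const (y := hD.toLp D)).compMeasurePreservingLp hg hgm
    ENNReal.ofReal_ne_top
  have h2 := (((ContinuousLinearMap.mul ℝ ℝ).lpPairing ν (ENNReal.ofReal q) (ENNReal.ofReal p))
    (hH.toLp H)).continuous.comp h1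
  refine h2.congr fun t => ?_
  rw [Function.comp_apply, ContinuousLinearMap.lpPairing_eq_integral]
  refine integral_congr_ae ?_
  have h3 := Lp.coeFn_compMeasurePreserving (hD.toLp D) (hgm t)
  have h4 := (hgm t).quasiMeasurePreserving.ae_eq_comp hD.coeFn_toLp
  filter_upwards [hH.coeFn_toLp, h3, h4] with z hz1 hz3 hz4
  rw [hz1, hz3, hz4]
  rfl

lemma integrable_mul_mul_comp_sub {κ : Measure (Rn n)} [SFinite κ] (hpq : q.HolderConjugate p)
    (hH : MemLp H (ENNReal.ofReal q) ν) (hHm : Measurable H)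
    (hD : MemLp D (ENNReal.ofReal p) ν) (hDm : Measurable D) (hι : Continuous ι) {ρ : Rn n → ℝ}
    (hρ : Integrable ρ κ) (hρm : Measurable ρ) :
    Integrable (fun w : Rn n × Y => ρ w.1 * (H w.2 * D (w.2 - ι w.1))) (κ.prod ν) := by
  have hc : (ENNReal.ofReal q).HolderConjugate (ENNReal.ofReal p) := hpq.ennrealOfReal
  have hιm : Measurable ι := hι.measurable
  have hm : Measurable fun w : Rn n × Y => ρ w.1 * (H w.2 * D (w.2 - ι w.1)) := by
    fun_prop
  have hHn : MemLp (fun z => ‖H z‖) (ENNReal.ofReal q) ν := hH.norm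
  have hDn : MemLp (fun z => ‖D z‖) (ENNReal.ofReal p) ν := hD.norm
  have hi_int : ∀ t, Integrable (fun z => H z * D (z - ι t)) ν := fun t =>
    hH.integrable_mul (hD.comp_measurePreserving (measurePreserving_sub_right ν (ι t)))
  rw [integrable_prod_iff hm.aestronglyMeasurable]
  refine ⟨ae_of_all _ fun t => (hi_int t).const_mul (ρ t), ?_⟩
  have hb : ∃ C, ∀ t, ∫ z, ‖H z * D (z - ι t)‖ ∂ν ≤ C := by
    refine ⟨(∫ z, ‖H z‖ ^ q ∂ν) ^ (1 / q) * (∫ z, ‖D z‖ ^ p ∂ν) ^ (1 / p), fun t => ?_⟩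
    have := integral_mul_le_Lp_mul_Lq_of_nonneg hpq (ae_of_all ν fun z => norm_nonneg (H z))
      (ae_of_all ν fun z => norm_nonneg (D (z - ι t))) hHn
      (hDn.comp_measurePreserving (measurePreserving_sub_right ν (ι t)))
    simp only [norm_mul]
    rwa [integral_sub_right_eq_self (fun z => ‖D z‖ ^ p) (ι t)] at this
  obtain ⟨C, hC⟩ := hb
  refine (hρ.norm.mul_const C).mono' hm.aestronglyMeasurable.norm.integral_prod_right' ?_
  refine ae_of_all _ fun t => ?_
  rw [Real.norm_of_nonneg (integral_nonneg fun _ => norm_nonneg _)]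
  simp only [norm_mul (ρ t)]
  rw [integral_const_mul]
  gcongr
  exact hC t

lemma integrable_mul_integral_comp_sub {κ : Measure (Rn n)} [SFinite κ] (hpq : q.HolderConjugate p)
    (hH : MemLp H (ENNReal.ofReal q) ν) (hHm : Measurable H)
    (hD : MemLp D (ENNReal.ofReal p) ν) (hDm : Measurable D) (hι : Continuous ι) {ρ : Rn n → ℝ}
    (hρ : Integrable ρ κ) (hρm : Measurable ρ) :
    Integrable (fun z => H z * ∫ t, ρ t * D (z - ι t) ∂κ) ν := by
  have h := (integrable_mul_mul_comp_sub hpq hH hHm hD hDm hι hρ hρm).integral_prod_right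
  refine h.congr (ae_of_all _ fun z => ?_)
  simp only [← integral_const_mul]
  exact integral_congr_ae (ae_of_all _ fun t => by ring)

lemma integral_mul_integral_comp_sub {κ : Measure (Rn n)} [SFinite κ] (hpq : q.HolderConjugate p)
    (hH : MemLp H (ENNReal.ofReal q) ν) (hHm : Measurable H)
    (hD : MemLp D (ENNReal.ofReal p) ν) (hDm : Measurable D) (hι : Continuous ι) {ρ : Rn n → ℝ}
    (hρ : Integrable ρ κ) (hρm : Measurable ρ) :
    ∫ z, H z * ∫ t, ρ t * D (z - ι t) ∂κ ∂ν = ∫ t, ρ t * ∫ z, H z * D (z - ι t) ∂ν ∂κ := by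
  have h := integral_integral_swap (f := fun t z => ρ t * (H z * D (z - ι t)))
    (integrable_mul_mul_comp_sub hpq hH hHm hD hDm hι hρ hρm)
  simp only [integral_const_mul] at h
  rw [h]
  refine integral_congr_ae (ae_of_all _ fun z => ?_)
  simp only [← integral_const_mul]
  exact integral_congr_ae (ae_of_all _ fun t => by ring)

end Mollification

/-- A continuous function all of whose averages against bumps concentrated at `0` vanish is zero at
the origin. -/
lemma eq_zero_of_integral_bump_eq_zero {n : ℕ} {g : Rn n → ℝ} {δ : ℝ} (hδ : 0 < δ)
    (hg : Continuous g)
    (h : ∀ ρ : ContDiffBump (0 : Rn n), ρ.rOut < δ → ∫ t, ρ.normed volume t * g t = 0) :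
    g 0 = 0 := by
  by_contra hne
  have hε : 0 < |g 0| / 2 := by positivity
  obtain ⟨η, hη, hball⟩ := Metric.continuous_iff.1 hg 0 _ hε
  let r := min (δ / 2) η
  have hr : 0 < r := lt_min (by positivity) hη
  let ρ : ContDiffBump (0 : Rn n) := ⟨r / 2, r, by positivity, by linarith⟩
  have h1 := ρ.dist_normed_convolution_le (μ := volume) (g := fun t => g (-t)) (x₀ := 0)
    (ε := |g 0| / 2) (by fun_prop) (by
      intro x hx
      rw [neg_zero]
      refine (hball (-x) ?_).le
      rw [dist_zero_right, norm_neg]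
      have : ‖x‖ < r := by simpa using hx
      exact this.trans_le (min_le_right _ _))
  rw [convolution_def] at h1
  simp only [zero_sub, neg_neg, neg_zero, ContinuousLinearMap.lsmul_apply, smul_eq_mul] at h1
  rw [h ρ ((min_le_left _ _).trans_lt (by linarith)), dist_zero_left, Real.norm_eq_abs] at h1
  have : 0 < |g 0| := abs_pos.2 hne
  linarith

lemma memLp_ofReal_of_lintegral_lt_top {Y : Type*} [MeasurableSpace Y] {ν : Measure Y} {f : Y → ℝ}
    {p : ℝ} (hp : 0 < p) (hf : Measurable f) (h : ∫⁻ z, ENNReal.ofReal (|f z| ^ p) ∂ν < ⊤) :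
    MemLp f (ENNReal.ofReal p) ν := by
  refine ⟨hf.aestronglyMeasurable, ?_⟩
  rw [eLpNorm_lt_top_iff_lintegral_rpow_enorm_lt_top (by simpa using hp) ENNReal.ofReal_ne_top,
    ENNReal.toReal_ofReal hp.le]
  refine lt_of_eq_of_lt (lintegral_congr fun z => ?_) h
  rw [Real.enorm_eq_ofReal_abs, ENNReal.ofReal_rpow_of_nonneg (abs_nonneg _) hp.le]

/-- The fractional difference quotient whose `L^p` norm is the Gagliardo seminorm of `φ`. -/
def fracQuotient (n : ℕ) (s p : ℝ) (φ : Rn n → ℝ) (z : Rn n × Rn n) : ℝ :=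
  (φ z.1 - φ z.2) / ‖z.1 - z.2‖ ^ (((n : ℝ) + s * p) / p)

/-- The factor complementary to `fracQuotient` in the nonlocal form of `u`. -/
def fracFlux (n : ℕ) (s p : ℝ) (Φ : ℝ → ℝ) (K : Rn n → Rn n → ℝ) (u : Rn n → ℝ)
    (z : Rn n × Rn n) : ℝ :=
  Φ (u z.1 - u z.2) * K z.1 z.2 * ‖z.1 - z.2‖ ^ (((n : ℝ) + s * p) / p)

section FracQuotient

variable {n : ℕ} {s p Λ : ℝ} {Φ : ℝ → ℝ} {K : Rn n → Rn n → ℝ} {u φ : Rn n → ℝ}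

lemma measurable_fracQuotient (hφ : Measurable φ) : Measurable (fracQuotient n s p φ) := by
  unfold fracQuotient
  fun_prop

lemma measurable_fracFlux (hΦ : Continuous Φ) (hK : Measurable (Function.uncurry K))
    (hu : Measurable u) : Measurable (fracFlux n s p Φ K u) := by
  have hK' : Measurable fun z : Rn n × Rn n => K z.1 z.2 := hK
  have hΦ' := hΦ.measurable
  unfold fracFlux
  fun_prop

lemma abs_fracQuotient_rpow (hp : 0 < p) (φ : Rn n → ℝ) (x y : Rn n) :
    |fracQuotient n s p φ (x, y)| ^ p = |φ x - φ y| ^ p / ‖x - y‖ ^ ((n : ℝ) + s * p) := by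
  rw [fracQuotient, abs_div, Real.div_rpow (abs_nonneg _) (abs_nonneg _),
    abs_of_nonneg (by positivity : 0 ≤ ‖x - y‖ ^ (((n : ℝ) + s * p) / p)),
    ← Real.rpow_mul (norm_nonneg _), div_mul_cancel₀ _ hp.ne']

lemma lintegral_abs_fracQuotient_rpow (hp : 0 < p) (hφ : Measurable φ) :
    ∫⁻ z, ENNReal.ofReal (|fracQuotient n s p φ z| ^ p) ∂(volume : Measure (Rn n)).prod volume =
      gagliardo n s p univ φ := by
  have h := measurable_fracQuotient (s := s) (p := p) hφ
  rw [lintegral_prod _ (by fun_prop), gagliardo]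
  simp only [Measure.restrict_univ, abs_fracQuotient_rpow hp]

lemma memLp_fracQuotient (hp : 0 < p) (hφ : Measurable φ) (h : gagliardo n s p univ φ < ⊤) :
    MemLp (fracQuotient n s p φ) (ENNReal.ofReal p) ((volume : Measure (Rn n)).prod volume) :=
  memLp_ofReal_of_lintegral_lt_top hp (measurable_fracQuotient hφ)
    (by rwa [lintegral_abs_fracQuotient_rpow hp hφ])

lemma PhiBounds.abs_le (hΦ : PhiBounds Λ p Φ) (hΛ : 0 < Λ) (hp : 1 < p) (t : ℝ) :
    |Φ t| ≤ Λ * |t| ^ (p - 1) := by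
  rcases eq_or_ne t 0 with rfl | ht
  · rw [hΦ.2.1, abs_zero, Real.zero_rpow (by linarith), mul_zero]
  · have ht' : 0 < |t| := abs_pos.2 ht
    have h1 := hΦ.2.2 t
    have h2 : |t| ^ p = |t| ^ (p - 1) * |t| := by
      rw [← Real.rpow_add_one ht'.ne', sub_add_cancel]
    have h3 : 0 ≤ |t| ^ p / Λ := by positivity
    refine le_of_mul_le_mul_right ?_ ht'
    rw [← abs_mul, abs_of_nonneg (h3.trans h1.1), mul_assoc, ← h2]
    exact h1.2

lemma PhiBounds.le_abs (hΦ : PhiBounds Λ p Φ) (hΛ : 0 < Λ) (hp : 1 < p) (t : ℝ) :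
    |t| ^ (p - 1) / Λ ≤ |Φ t| := by
  rcases eq_or_ne t 0 with rfl | ht
  · rw [hΦ.2.1, abs_zero, Real.zero_rpow (by linarith), zero_div]
  · have ht' : 0 < |t| := abs_pos.2 ht
    have h1 := hΦ.2.2 t
    have h2 : |t| ^ p = |t| ^ (p - 1) * |t| := by
      rw [← Real.rpow_add_one ht'.ne', sub_add_cancel]
    have h3 : 0 ≤ |t| ^ p / Λ := by positivity
    refine le_of_mul_le_mul_right ?_ ht'
    rw [← abs_mul, abs_of_nonneg (h3.trans h1.1), div_mul_eq_mul_div, ← h2]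
    exact h1.1

lemma KernelBounds.nonneg (hK : KernelBounds n Λ s p K) (hΛ : 0 < Λ) {x y : Rn n} (h : x ≠ y) :
    0 ≤ K x y :=
  le_trans (by positivity) (hK.2 x y h).1

lemma abs_fracFlux_le (hK : KernelBounds n Λ s p K) (hΦ : PhiBounds Λ p Φ) (hΛ : 0 < Λ)
    (hp : 1 < p) (z : Rn n × Rn n) :
    |fracFlux n s p Φ K u z| ≤ Λ ^ 2 * |fracQuotient n s p u z| ^ (p - 1) := by
  obtain ⟨x, y⟩ := z
  rcases eq_or_ne x y with rfl | hxy
  · simp only [fracFlux, sub_self, hΦ.2.1, zero_mul, abs_zero]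
    positivity
  have hd : 0 < ‖x - y‖ := norm_pos_iff.2 (sub_ne_zero.2 hxy)
  set α := (n : ℝ) + s * p with hα
  have h1 : |fracFlux n s p Φ K u (x, y)| = |Φ (u x - u y)| * K x y * ‖x - y‖ ^ (α / p) := by
    simp only [fracFlux, abs_mul, ← hα]
    rw [abs_of_nonneg (hK.nonneg hΛ hxy), abs_of_nonneg (by positivity : 0 ≤ ‖x - y‖ ^ (α / p))]
  have h2 : |fracQuotient n s p u (x, y)| ^ (p - 1) =
      |u x - u y| ^ (p - 1) * (‖x - y‖ ^ (α / p) / ‖x - y‖ ^ α) := by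
    simp only [fracQuotient, abs_div, ← hα]
    rw [abs_of_nonneg (by positivity : 0 ≤ ‖x - y‖ ^ (α / p)),
      Real.div_rpow (abs_nonneg _) (by positivity), ← Real.rpow_mul hd.le, ← Real.rpow_sub hd,
      div_eq_mul_inv, ← Real.rpow_neg hd.le]
    congr 2
    field_simp
    ring
  rw [h1, h2]
  calc |Φ (u x - u y)| * K x y * ‖x - y‖ ^ (α / p)
      ≤ (Λ * |u x - u y| ^ (p - 1)) * (Λ / ‖x - y‖ ^ α) * ‖x - y‖ ^ (α / p) := by
        gcongr
        · exact hK.nonneg hΛ hxy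
        · exact hΦ.abs_le hΛ hp _
        · exact (hK.2 x y hxy).2
    _ = _ := by ring

lemma memLp_fracFlux (hK : KernelBounds n Λ s p K) (hΦ : PhiBounds Λ p Φ) (hΛ : 0 < Λ)
    (hp : 1 < p) (hu : Measurable u) (h : gagliardo n s p univ u < ⊤) {q : ℝ}
    (hpq : q.HolderConjugate p) :
    MemLp (fracFlux n s p Φ K u) (ENNReal.ofReal q) ((volume : Measure (Rn n)).prod volume) := by
  refine memLp_ofReal_of_lintegral_lt_top hpq.pos (measurable_fracFlux hΦ.1 hK.1 hu) ?_
  have hm := measurable_fracQuotient (s := s) (p := p) hu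
  calc ∫⁻ z, ENNReal.ofReal (|fracFlux n s p Φ K u z| ^ q) ∂(volume : Measure (Rn n)).prod volume
      ≤ ∫⁻ z, ENNReal.ofReal ((Λ ^ 2) ^ q) * ENNReal.ofReal (|fracQuotient n s p u z| ^ p)
          ∂(volume : Measure (Rn n)).prod volume := by
        refine lintegral_mono fun z => ?_
        rw [← ENNReal.ofReal_mul (by positivity)]
        refine ENNReal.ofReal_le_ofReal ?_
        refine (Real.rpow_le_rpow (abs_nonneg _) (abs_fracFlux_le hK hΦ hΛ hp z)
          hpq.nonneg).trans ?_
        rw [Real.mul_rpow (by positivity) (by positivity), ← Real.rpow_mul (abs_nonneg _)]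
        rw [hpq.symm.sub_one_mul_conj]
    _ < ⊤ := by
        rw [lintegral_const_mul _ (by fun_prop), lintegral_abs_fracQuotient_rpow (by linarith) hu]
        exact ENNReal.mul_lt_top ENNReal.ofReal_lt_top h

lemma fracFlux_mul_fracQuotient (h0 : Φ 0 = 0) (z : Rn n × Rn n) :
    fracFlux n s p Φ K u z * fracQuotient n s p φ z =
      Φ (u z.1 - u z.2) * (φ z.1 - φ z.2) * K z.1 z.2 := by
  obtain ⟨x, y⟩ := z
  rcases eq_or_ne x y with rfl | hxy
  · simp [fracFlux, h0]
  have hd : 0 < ‖x - y‖ := norm_pos_iff.2 (sub_ne_zero.2 hxy)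
  have : ‖x - y‖ ^ (((n : ℝ) + s * p) / p) ≠ 0 := by positivity
  simp only [fracFlux, fracQuotient]
  field_simp

lemma nonlocalForm_eq_integral (h0 : Φ 0 = 0)
    (h : Integrable (fun z => fracFlux n s p Φ K u z * fracQuotient n s p φ z)
      ((volume : Measure (Rn n)).prod volume)) :
    nonlocalForm n Φ K u φ = ∫ z, fracFlux n s p Φ K u z * fracQuotient n s p φ z
      ∂(volume : Measure (Rn n)).prod volume := by
  rw [integral_prod _ h]
  simp only [fracFlux_mul_fracQuotient h0, nonlocalForm]

end FracQuotient

section WeakFormulation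

variable {n : ℕ} {s p Λ : ℝ} {Φ : ℝ → ℝ} {K : Rn n → Rn n → ℝ} {u φ f : Rn n → ℝ} {Ω : Set (Rn n)}
  {x₀ : Rn n} {R R' N : ℝ}

lemma integrable_bump_mul_comp_sub (ρ : ContDiffBump (0 : Rn n)) (hφ : Measurable φ)
    (hN : ∀ x, |φ x| ≤ N) (x : Rn n) :
    Integrable fun t => ρ.normed volume t * φ (x - t) :=
  ρ.integrable_normed.mul_bdd (c := N)
    (hφ.comp (measurable_const.sub measurable_id)).aestronglyMeasurable
      (ae_of_all _ fun t => hN (x - t))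

lemma isTestFun_mollification (ρ : ContDiffBump (0 : Rn n)) (hφ : Measurable φ)
    (hN : ∀ x, |φ x| ≤ N) (hz : ∀ x ∉ ball x₀ R, φ x = 0) (hρ : R + ρ.rOut < R')
    (hΩ : ball x₀ R' ⊆ Ω) :
    IsTestFun n Ω fun x => ∫ t, ρ.normed volume t * φ (x - t) := by
  have hsupp : Function.support (fun x => ∫ t, ρ.normed volume t * φ (x - t)) ⊆
      closedBall x₀ (R + ρ.rOut) := by
    intro x hx
    by_contra hx'
    refine hx (integral_eq_zero_of_ae (ae_of_all _ fun t => ?_))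
    change ρ.normed volume t * φ (x - t) = 0
    rw [mem_closedBall, not_le] at hx'
    by_cases ht : ‖t‖ < ρ.rOut
    · rw [hz, mul_zero]
      rw [mem_ball, not_lt]
      have h1 := dist_triangle x (x - t) x₀
      have h2 : dist x (x - t) = ‖t‖ := by rw [dist_eq_norm, sub_sub_cancel]
      linarith
    · have : t ∉ Function.support (ρ.normed volume) := by
        rw [ρ.support_normed_eq]
        simpa using ht
      rw [Function.notMem_support.1 this, zero_mul]
  refine ⟨?_, HasCompactSupport.of_support_subset_isCompact (isCompact_closedBall _ _) hsupp, ?_⟩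
  · have hloc : LocallyIntegrable φ :=
      (locallyIntegrable_const N).mono hφ.aestronglyMeasurable
        (ae_of_all _ fun x => (hN x).trans (le_abs_self N))
    exact ρ.hasCompactSupport_normed.contDiff_convolution_left (ContinuousLinearMap.mul ℝ ℝ)
      ρ.contDiff_normed hloc
  · refine (closure_minimal hsupp isClosed_closedBall).trans ((closedBall_subset_ball hρ).trans hΩ)

lemma fracQuotient_mollification (ρ : ContDiffBump (0 : Rn n)) (hφ : Measurable φ)
    (hN : ∀ x, |φ x| ≤ N) (z : Rn n × Rn n) :
    fracQuotient n s p (fun x => ∫ t, ρ.normed volume t * φ (x - t)) z =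
      ∫ t, ρ.normed volume t * fracQuotient n s p φ (z - (t, t)) := by
  rw [fracQuotient, ← integral_sub (integrable_bump_mul_comp_sub ρ hφ hN _)
    (integrable_bump_mul_comp_sub ρ hφ hN _), ← integral_div]
  refine integral_congr_ae (ae_of_all _ fun t => ?_)
  simp only [fracQuotient, Prod.fst_sub, Prod.snd_sub, sub_sub_sub_cancel_right]
  ring

/-- A weak solution may be tested with bounded functions of finite Gagliardo energy supported well
inside the domain. -/
lemma integral_fracFlux_mul_fracQuotient (hK : KernelBounds n Λ s p K) (hΦ : PhiBounds Λ p Φ)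
    (hΛ : 0 < Λ) (hp : 1 < p) (hu : Measurable u) (hug : gagliardo n s p univ u < ⊤)
    (hf : Continuous f) (hfc : HasCompactSupport f)
    (hw : ∀ ψ, IsTestFun n Ω ψ → nonlocalForm n Φ K u ψ = ∫ x, ψ x * f x)
    (hφ : Measurable φ) (hN : ∀ x, |φ x| ≤ N) (hφg : gagliardo n s p univ φ < ⊤)
    (hz : ∀ x ∉ ball x₀ R, φ x = 0) (hR : R < R') (hΩ : ball x₀ R' ⊆ Ω) :
    ∫ z, fracFlux n s p Φ K u z * fracQuotient n s p φ z ∂(volume : Measure (Rn n)).prod volume =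
      ∫ x, φ x * f x := by
  have hpq : (p / (p - 1)).HolderConjugate p := (Real.HolderConjugate.conjExponent hp).symm
  set q := p / (p - 1)
  have hp0 : 0 < p := by linarith
  have hH := memLp_fracFlux hK hΦ hΛ hp hu hug hpq
  have hHm := measurable_fracFlux (s := s) (p := p) hΦ.1 hK.1 hu
  have hD := memLp_fracQuotient hp0 hφ hφg
  have hDm := measurable_fracQuotient (s := s) (p := p) hφ
  have hfL : MemLp f (ENNReal.ofReal q) volume := hf.memLp_of_hasCompactSupport hfc
  have hφL : MemLp φ (ENNReal.ofReal p) volume := by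
    have h1 : φ = (ball x₀ R).indicator φ := by
      ext x
      by_cases hx : x ∈ ball x₀ R
      · rw [indicator_of_mem hx]
      · rw [indicator_of_notMem hx, hz x hx]
    rw [h1, memLp_indicator_iff_restrict measurableSet_ball]
    have : IsFiniteMeasure (volume.restrict (ball x₀ R)) :=
      ⟨by rw [Measure.restrict_apply_univ]; exact measure_ball_lt_top⟩
    exact MemLp.of_bound hφ.aestronglyMeasurable N (ae_of_all _ hN)
  have hι : Continuous fun t : Rn n => (t, t) := by fun_prop
  have hc1 := continuous_integral_mul_comp_sub hpq hH hD hι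
  have hc2 := continuous_integral_mul_comp_sub hpq hfL hφL continuous_id
  have key := eq_zero_of_integral_bump_eq_zero (sub_pos.2 hR) (hc1.sub hc2) (fun ρ hρ => ?_)
  · have h0 : ((0 : Rn n), (0 : Rn n)) = 0 := rfl
    simp only [Pi.sub_apply, id, h0, sub_zero] at key
    rw [sub_eq_zero.1 key]
    exact integral_congr_ae (ae_of_all _ fun x => mul_comm _ _)
  · have hρi : Integrable (ρ.normed volume) volume := ρ.integrable_normed
    have hρm : Measurable (ρ.normed volume) := ρ.continuous_normed.measurable
    have h1 := integral_mul_integral_comp_sub hpq hH hHm hD hDm hι hρi hρm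
    have h2 := integral_mul_integral_comp_sub hpq hfL hf.measurable hφL hφ continuous_id hρi hρm
    have h3 := integrable_mul_integral_comp_sub hpq hH hHm hD hDm hι hρi hρm
    have h4 := hw _ (isTestFun_mollification ρ hφ hN hz (by linarith) hΩ)
    simp only [← fracQuotient_mollification ρ hφ hN] at h1 h3
    rw [nonlocalForm_eq_integral hΦ.2.1 h3, h1] at h4
    have hi_int : ∀ {G : Rn n → ℝ}, Continuous G → Integrable fun t => ρ.normed volume t * G t :=
      fun hG => (ρ.continuous_normed.mul hG).integrable_of_hasCompactSupport
        ρ.hasCompactSupport_normed.mul_right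
    simp only [Pi.sub_apply, mul_sub]
    rw [integral_sub (hi_int hc1) (hi_int hc2), h4, ← h2, sub_eq_zero]
    exact integral_congr_ae (ae_of_all _ fun x => mul_comm _ _)

end WeakFormulation

section SignedEnergy

variable {n : ℕ} {s p Λ : ℝ} {Φ : ℝ → ℝ} {K : Rn n → Rn n → ℝ} {u φ f : Rn n → ℝ} {Ω : Set (Rn n)}
  {x₀ : Rn n} {R R' N : ℝ}

lemma PhiBounds.exists_max_mul_eq (hΦ : PhiBounds Λ p Φ) (hΛ : 0 < Λ) (hp : 1 < p) (t d : ℝ) :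
    ∃ m, 0 ≤ m ∧ max (Φ t * d) 0 = |Φ t| * m ∧
      (max t 0) ^ (p - 1) * max d 0 + (max (-t) 0) ^ (p - 1) * max (-d) 0 = |t| ^ (p - 1) * m := by
  have hp1 : p - 1 ≠ 0 := by linarith
  have h1 : 0 ≤ Φ t * t := le_trans (by positivity) (hΦ.2.2 t).1
  rcases lt_trichotomy t 0 with ht | rfl | ht
  · refine ⟨max (-d) 0, le_max_right _ _, ?_, ?_⟩
    · have h2 : Φ t ≤ 0 := by nlinarith
      rw [abs_of_nonpos h2, mul_max_of_nonneg _ _ (by linarith), mul_zero, neg_mul_neg]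
    · rw [max_eq_right ht.le, max_eq_left (a := -t) (by linarith), Real.zero_rpow hp1,
        abs_of_neg ht,
        zero_mul,
        zero_add]
  · refine ⟨0, le_rfl, ?_, ?_⟩
    · simp [hΦ.2.1]
    · simp [Real.zero_rpow hp1]
  · refine ⟨max d 0, le_max_right _ _, ?_, ?_⟩
    · have h2 : 0 ≤ Φ t := by nlinarith
      rw [abs_of_nonneg h2, mul_max_of_nonneg _ _ h2, mul_zero]
    · rw [max_eq_left ht.le, max_eq_right (a := -t) (by linarith), Real.zero_rpow hp1,
        abs_of_pos ht,
        zero_mul, add_zero]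

/-- The integrand of `alignedEnergy`. -/
def alignedDensity (n : ℕ) (s p : ℝ) (u φ : Rn n → ℝ) (x y : Rn n) : ℝ :=
  (max (u x - u y) 0) ^ (p - 1) * max (φ x - φ y) 0 / ‖x - y‖ ^ ((n : ℝ) + s * p)

lemma alignedDensity_nonneg (u φ : Rn n → ℝ) (x y : Rn n) : 0 ≤ alignedDensity n s p u φ x y := by
  unfold alignedDensity
  positivity

lemma measurable_alignedDensity (hu : Measurable u) (hφ : Measurable φ) :
    Measurable fun z : Rn n × Rn n => alignedDensity n s p u φ z.1 z.2 := by
  unfold alignedDensity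
  fun_prop

lemma lintegral_alignedDensity_add_swap (hu : Measurable u) (hφ : Measurable φ) :
    ∫⁻ z, ENNReal.ofReal (alignedDensity n s p u φ z.1 z.2 + alignedDensity n s p u φ z.2 z.1)
      ∂(volume : Measure (Rn n)).prod volume = 2 * alignedEnergy n s p u φ := by
  have hm := measurable_alignedDensity (s := s) (p := p) hu hφ
  have h1 : ∫⁻ z, ENNReal.ofReal (alignedDensity n s p u φ z.1 z.2)
      ∂(volume : Measure (Rn n)).prod volume = alignedEnergy n s p u φ := by
    rw [lintegral_prod _ (by fun_prop)]
    rfl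
  simp only [ENNReal.ofReal_add (alignedDensity_nonneg _ _ _ _) (alignedDensity_nonneg _ _ _ _)]
  rw [lintegral_add_left (by fun_prop), h1, two_mul, ← h1]
  congr 1
  exact lintegral_prod_swap (fun z : Rn n × Rn n =>
    ENNReal.ofReal (alignedDensity n s p u φ z.1 z.2))

lemma max_form_bounds (hK : KernelBounds n Λ s p K) (hΦ : PhiBounds Λ p Φ) (hΛ : 0 < Λ) (hp : 1 < p)
    (x y : Rn n) :
    max (Φ (u x - u y) * (φ x - φ y) * K x y) 0 ≤
        Λ ^ 2 * (alignedDensity n s p u φ x y + alignedDensity n s p u φ y x) ∧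
      alignedDensity n s p u φ x y + alignedDensity n s p u φ y x ≤
        Λ ^ 2 * max (Φ (u x - u y) * (φ x - φ y) * K x y) 0 := by
  rcases eq_or_ne x y with rfl | hxy
  · simp [alignedDensity, hΦ.2.1]
  have hd : 0 < ‖x - y‖ := norm_pos_iff.2 (sub_ne_zero.2 hxy)
  obtain ⟨m, hm0, hm, hm'⟩ := hΦ.exists_max_mul_eq hΛ hp (u x - u y) (φ x - φ y)
  have hKn := hK.nonneg hΛ hxy
  obtain ⟨hK1, hK2⟩ := hK.2 x y hxy
  have hΦ1 := hΦ.abs_le hΛ hp (u x - u y)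
  have hΦ2 := hΦ.le_abs hΛ hp (u x - u y)
  set D := ‖x - y‖ ^ ((n : ℝ) + s * p) with hD
  have hDpos : 0 < D := by positivity
  have e1 : max (Φ (u x - u y) * (φ x - φ y) * K x y) 0 = |Φ (u x - u y)| * m * K x y := by
    rw [← hm, max_mul_of_nonneg _ _ hKn, zero_mul]
  have e2 : alignedDensity n s p u φ x y + alignedDensity n s p u φ y x =
      |u x - u y| ^ (p - 1) * m / D := by
    rw [← hm', alignedDensity, alignedDensity, norm_sub_rev y x, ← hD, neg_sub, neg_sub]
    ring
  rw [e1, e2]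
  constructor
  · calc |Φ (u x - u y)| * m * K x y ≤ (Λ * |u x - u y| ^ (p - 1)) * m * (Λ / D) := by gcongr
      _ = _ := by ring
  · calc |u x - u y| ^ (p - 1) * m / D
        = Λ ^ 2 * ((|u x - u y| ^ (p - 1) / Λ) * m * (1 / (Λ * D))) := by field_simp
      _ ≤ Λ ^ 2 * (|Φ (u x - u y)| * m * K x y) := by gcongr

lemma ofReal_integral_add_lintegral_le {Y : Type*} [MeasurableSpace Y] {ν : Measure Y} {F : Y → ℝ}
    (hF : Integrable F ν) (h0 : 0 ≤ ∫ z, F z ∂ν) :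
    ENNReal.ofReal (∫ z, F z ∂ν) + ∫⁻ z, ENNReal.ofReal (-F z) ∂ν =
      ∫⁻ z, ENNReal.ofReal (F z) ∂ν := by
  have h1 : ∫⁻ z, ENNReal.ofReal (F z) ∂ν ≠ ⊤ := hF.lintegral_lt_top.ne
  have h2 : ∫⁻ z, ENNReal.ofReal (-F z) ∂ν ≠ ⊤ := hF.neg.lintegral_lt_top.ne
  rw [← ENNReal.ofReal_toReal h1, ← ENNReal.ofReal_toReal h2,
    ← ENNReal.ofReal_add h0 ENNReal.toReal_nonneg]
  rw [integral_eq_lintegral_pos_part_sub_lintegral_neg_part hF, sub_add_cancel]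

/-- Testing the equation with `φ` and separating the signs of the integrand. -/
lemma energy_inequality (hK : KernelBounds n Λ s p K) (hΦ : PhiBounds Λ p Φ)
    (hΛ : 1 ≤ Λ) (hp : 1 < p) (hu : Measurable u) (hug : gagliardo n s p univ u < ⊤)
    (hf : Continuous f) (hfc : HasCompactSupport f) (hf0 : ∀ x, 0 ≤ f x)
    (hw : ∀ ψ, IsTestFun n Ω ψ → nonlocalForm n Φ K u ψ = ∫ x, ψ x * f x)
    (hφ : Measurable φ) (hφ0 : ∀ x, 0 ≤ φ x) (hN : ∀ x, φ x ≤ N)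
    (hφg : gagliardo n s p univ φ < ⊤)
    (hz : ∀ x ∉ ball x₀ R, φ x = 0) (hR : R < R') (hΩ : ball x₀ R' ⊆ Ω) :
    ENNReal.ofReal ((∫ x, φ x * f x) / 2) + alignedEnergy n s p u (fun x => -φ x) ≤
      ENNReal.ofReal (Λ ^ 4) * alignedEnergy n s p u φ := by
  have hΛ0 : 0 < Λ := by linarith
  have hp0 : 0 < p := by linarith
  have hpq : (p / (p - 1)).HolderConjugate p := (Real.HolderConjugate.conjExponent hp).symm
  have hc : (ENNReal.ofReal (p / (p - 1))).HolderConjugate (ENNReal.ofReal p) := hpq.ennrealOfReal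
  have hF : Integrable (fun z => fracFlux n s p Φ K u z * fracQuotient n s p φ z)
      ((volume : Measure (Rn n)).prod volume) :=
    (memLp_fracFlux hK hΦ hΛ0 hp hu hug hpq).integrable_mul (memLp_fracQuotient hp0 hφ hφg)
  have h1 := integral_fracFlux_mul_fracQuotient hK hΦ hΛ0 hp hu hug hf hfc hw hφ
    (fun x => by rw [abs_of_nonneg (hφ0 x)]; exact hN x) hφg hz hR hΩ
  have h0 : 0 ≤ ∫ x, φ x * f x := integral_nonneg fun x => mul_nonneg (hφ0 x) (hf0 x)
  have h2 := ofReal_integral_add_lintegral_le hF (h1 ▸ h0)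
  rw [h1] at h2
  simp only [fracFlux_mul_fracQuotient hΦ.2.1] at h2
  have hpos : ∫⁻ z, ENNReal.ofReal (Φ (u z.1 - u z.2) * (φ z.1 - φ z.2) * K z.1 z.2)
      ∂(volume : Measure (Rn n)).prod volume ≤
      ENNReal.ofReal (Λ ^ 2) * (2 * alignedEnergy n s p u φ) := by
    rw [← lintegral_alignedDensity_add_swap hu hφ, ← lintegral_const_mul' _ _ ENNReal.ofReal_ne_top]
    refine lintegral_mono fun z => ?_
    rw [← ENNReal.ofReal_mul (by positivity)]
    exact ENNReal.ofReal_le_ofReal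
      ((le_max_left _ _).trans (max_form_bounds hK hΦ hΛ0 hp z.1 z.2).1)
  have hneg : 2 * alignedEnergy n s p u (fun x => -φ x) ≤ ENNReal.ofReal (Λ ^ 2) *
      ∫⁻ z, ENNReal.ofReal (-(Φ (u z.1 - u z.2) * (φ z.1 - φ z.2) * K z.1 z.2))
      ∂(volume : Measure (Rn n)).prod volume := by
    rw [← lintegral_alignedDensity_add_swap (φ := fun x => -φ x) hu hφ.neg,
      ← lintegral_const_mul' _ _ ENNReal.ofReal_ne_top]
    refine lintegral_mono fun z => ?_
    rw [← ENNReal.ofReal_mul (by positivity)]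
    have h3 := (max_form_bounds (u := u) (φ := fun x => -φ x) hK hΦ hΛ0 hp z.1 z.2).2
    have h4 : Φ (u z.1 - u z.2) * (-φ z.1 - -φ z.2) * K z.1 z.2 =
        -(Φ (u z.1 - u z.2) * (φ z.1 - φ z.2) * K z.1 z.2) := by ring
    rw [h4] at h3
    refine (ENNReal.ofReal_le_ofReal h3).trans ?_
    rw [mul_max_of_nonneg _ _ (by positivity), mul_zero]
    simp [ENNReal.ofReal_max]
  have h5 : 2 * (ENNReal.ofReal ((∫ x, φ x * f x) / 2) + alignedEnergy n s p u (fun x => -φ x)) ≤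
      2 * (ENNReal.ofReal (Λ ^ 4) * alignedEnergy n s p u φ) := by
    have e1 : 2 * ENNReal.ofReal ((∫ x, φ x * f x) / 2) = ENNReal.ofReal (∫ x, φ x * f x) := by
      rw [two_mul, ← ENNReal.ofReal_add (by positivity) (by positivity), add_halves]
    have hΛ2 : 1 ≤ ENNReal.ofReal (Λ ^ 2) := by
      rw [← ENNReal.ofReal_one]
      exact ENNReal.ofReal_le_ofReal (one_le_pow₀ hΛ)
    rw [mul_add, e1]
    calc _ ≤ ENNReal.ofReal (Λ ^ 2) * ENNReal.ofReal (∫ x, φ x * f x) + _ := by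
          exact add_le_add (le_mul_of_one_le_left' hΛ2) hneg
      _ ≤ ENNReal.ofReal (Λ ^ 2) * (ENNReal.ofReal (Λ ^ 2) * (2 * alignedEnergy n s p u φ)) := by
          rw [← mul_add, h2]
          gcongr
      _ = _ := by
          rw [← mul_assoc, ← ENNReal.ofReal_mul (by positivity), ← pow_add]
          ring
  exact (ENNReal.mul_le_mul_iff_right two_ne_zero ENNReal.ofNat_ne_top).1 h5

end SignedEnergy

lemma abs_sub_rpow_le_of_lip {p L N a b d : ℝ} (hp : 0 < p) (hL : 0 ≤ L) (hN : 0 ≤ N) (ha : 0 ≤ a)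
    (hb : 0 ≤ b) (h1 : |d| ≤ L * (a + b)) (h2 : |d| ≤ N) :
    |d| ^ p ≤ 2 ^ p * L ^ p * a ^ p + 2 ^ p * (N + L) ^ p * min 1 (b ^ p) := by
  have h3 : |d| ≤ L * a + (N + L) * min 1 b := by
    rcases le_total 1 b with h | h
    · rw [min_eq_left h]
      nlinarith [mul_nonneg hL ha]
    · rw [min_eq_right h]
      nlinarith [mul_nonneg hN hb]
  have h4 : min 1 (b ^ p) = (min 1 b) ^ p := by
    rcases le_total 1 b with h | h
    · rw [min_eq_left h, Real.one_rpow, min_eq_left (Real.one_le_rpow h hp.le)]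
    · rw [min_eq_right h, min_eq_right (Real.rpow_le_one hb h hp.le)]
  rw [h4]
  refine (Real.rpow_le_rpow (abs_nonneg _) h3 hp.le).trans
    ((add_rpow_le_two_rpow_mul (by positivity) (by positivity) hp.le).trans ?_)
  rw [Real.mul_rpow hL ha, Real.mul_rpow (by positivity) (by positivity)]
  exact le_of_eq (by ring)

lemma lintegral_indicator_ball_mul_lt_top {n : ℕ} {x₀ : Rn n} {R : ℝ} {k : Rn n → Rn n → ℝ≥0∞}
    {C : ℝ≥0} (hk : Measurable (Function.uncurry k)) (hC : ∀ x, ∫⁻ y, k x y ≤ C) :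
    ∫⁻ z, (ball x₀ R).indicator 1 z.1 * k z.1 z.2 ∂(volume : Measure (Rn n)).prod volume < ⊤ := by
  have hBm : Measurable ((ball x₀ R).indicator (1 : Rn n → ℝ≥0∞)) :=
    measurable_one.indicator measurableSet_ball
  have hkm : Measurable fun z : Rn n × Rn n => k z.1 z.2 := hk
  rw [lintegral_prod _ (by fun_prop)]
  calc _ ≤ ∫⁻ x, (ball x₀ R).indicator 1 x * (C : ℝ≥0∞) := by
        refine lintegral_mono fun x => ?_
        have hkx : Measurable (k x) := hkm.comp measurable_prodMk_left
        dsimp only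
        rw [lintegral_const_mul _ hkx]
        gcongr
        exact hC x
    _ = volume (ball x₀ R) * C := by
        rw [lintegral_mul_const _ hBm, lintegral_indicator_one measurableSet_ball]
    _ < ⊤ := ENNReal.mul_lt_top measure_ball_lt_top ENNReal.coe_lt_top

/-- Bounded, compactly supported functions that are Lipschitz relative to `u` inherit finite
Gagliardo energy from `u`. -/
lemma gagliardo_lt_top_of_abs_sub_le {n : ℕ} {s p L N R : ℝ} {u φ : Rn n → ℝ} {x₀ : Rn n}
    (hn : 1 ≤ n)
    (hs : 0 < s) (hs1 : s < 1) (hp : 1 < p) (hu : Measurable u) (hug : gagliardo n s p univ u < ⊤)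
    (hL : 0 ≤ L) (hlip : ∀ x y, |φ x - φ y| ≤ L * (|u x - u y| + ‖x - y‖))
    (hφ : Measurable φ) (hφ0 : ∀ x, 0 ≤ φ x) (hN : ∀ x, φ x ≤ N) (hz : ∀ x ∉ ball x₀ R, φ x = 0) :
    gagliardo n s p univ φ < ⊤ := by
  have hp0 : 0 < p := by linarith
  have hN0 : 0 ≤ N := (hφ0 0).trans (hN 0)
  obtain ⟨C, hC⟩ := exists_lintegral_truncatedKernel_le hn hs hs1 hp0
  rw [← lintegral_abs_fracQuotient_rpow hp0 hφ]
  rw [← lintegral_abs_fracQuotient_rpow hp0 hu] at hug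
  obtain ⟨c₁, hc₁⟩ : ∃ c₁, c₁ = 2 ^ p * L ^ p := ⟨_, rfl⟩
  obtain ⟨c₂, hc₂⟩ : ∃ c₂, c₂ = 2 ^ p * (N + L) ^ p := ⟨_, rfl⟩
  have hc₁0 : 0 ≤ c₁ := by rw [hc₁]; positivity
  have hc₂0 : 0 ≤ c₂ := by rw [hc₂]; positivity
  obtain ⟨k, hk⟩ : ∃ k : Rn n → Rn n → ℝ≥0∞, k = fun x y =>
    ENNReal.ofReal (min 1 (‖x - y‖ ^ p) / ‖x - y‖ ^ ((n : ℝ) + s * p)) := ⟨_, rfl⟩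
  have hCk : ∀ x, ∫⁻ y, k x y ≤ C := by rwa [hk]
  have hkm : Measurable (Function.uncurry k) := by
    rw [hk]
    unfold Function.uncurry
    fun_prop
  obtain ⟨B, hB⟩ : ∃ B : Rn n → ℝ≥0∞, B = (ball x₀ R).indicator 1 := ⟨_, rfl⟩
  have hBm : Measurable B := by rw [hB]; exact measurable_one.indicator measurableSet_ball
  have hfm := measurable_fracQuotient (s := s) (p := p) hu
  have hpt : ∀ z : Rn n × Rn n, ENNReal.ofReal (|fracQuotient n s p φ z| ^ p) ≤
      ENNReal.ofReal c₁ * ENNReal.ofReal (|fracQuotient n s p u z| ^ p) +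
        ENNReal.ofReal c₂ * (B z.1 * k z.1 z.2 + B z.2 * k z.2 z.1) := by
    rintro ⟨x, y⟩
    dsimp only
    rw [abs_fracQuotient_rpow hp0, abs_fracQuotient_rpow hp0]
    by_cases hxy : x ∉ ball x₀ R ∧ y ∉ ball x₀ R
    · rw [hz x hxy.1, hz y hxy.2, sub_self, abs_zero, Real.zero_rpow hp0.ne', zero_div,
        ENNReal.ofReal_zero]
      exact zero_le
    have hksymm : k y x = k x y := by simp only [hk, norm_sub_rev]
    have hB1 : 1 ≤ B x + B y := by
      rw [not_and_or, not_not, not_not] at hxy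
      rcases hxy with h | h
      · exact le_add_right (by simp [hB, h])
      · exact le_add_left (by simp [hB, h])
    rw [hksymm, ← add_mul]
    calc ENNReal.ofReal (|φ x - φ y| ^ p / ‖x - y‖ ^ ((n : ℝ) + s * p))
        ≤ ENNReal.ofReal (c₁ * (|u x - u y| ^ p / ‖x - y‖ ^ ((n : ℝ) + s * p)) +
            c₂ * (min 1 (‖x - y‖ ^ p) / ‖x - y‖ ^ ((n : ℝ) + s * p))) := by
          refine ENNReal.ofReal_le_ofReal ?_
          rw [← mul_div_assoc, ← mul_div_assoc, ← add_div]
          refine div_le_div_of_nonneg_right ?_ (by positivity)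
          rw [hc₁, hc₂]
          exact abs_sub_rpow_le_of_lip hp0 hL hN0 (abs_nonneg _) (norm_nonneg _) (hlip x y)
            (abs_sub_le_of_nonneg_of_le (hφ0 x) (hN x) (hφ0 y) (hN y))
      _ = ENNReal.ofReal c₁ * ENNReal.ofReal (|u x - u y| ^ p / ‖x - y‖ ^ ((n : ℝ) + s * p)) +
            ENNReal.ofReal c₂ * (1 * k x y) := by
          rw [ENNReal.ofReal_add (by positivity) (by positivity), ENNReal.ofReal_mul hc₁0,
            ENNReal.ofReal_mul hc₂0, one_mul, hk]
      _ ≤ _ := by gcongr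
  have hkm' : Measurable fun z : Rn n × Rn n => k z.1 z.2 := hkm
  have hkm'' : Measurable fun z : Rn n × Rn n => k z.2 z.1 := hkm.comp measurable_swap
  have h1 := lintegral_indicator_ball_mul_lt_top (x₀ := x₀) (R := R) hkm hCk
  rw [← hB] at h1
  have h2 : ∫⁻ z, B z.2 * k z.2 z.1 ∂(volume : Measure (Rn n)).prod volume < ⊤ := by
    rwa [← lintegral_prod_swap] at h1
  refine (lintegral_mono hpt).trans_lt ?_
  rw [lintegral_add_left (by fun_prop), lintegral_const_mul' _ _ ENNReal.ofReal_ne_top,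
    lintegral_const_mul' _ _ ENNReal.ofReal_ne_top, lintegral_add_left (by fun_prop)]
  exact ENNReal.add_lt_top.2 ⟨ENNReal.mul_lt_top ENNReal.ofReal_lt_top hug,
    ENNReal.mul_lt_top ENNReal.ofReal_lt_top (ENNReal.add_lt_top.2 ⟨h1, h2⟩)⟩

section Scaling

variable {n : ℕ} {s p Λ r d : ℝ} {u φ : Rn n → ℝ} {x₀ : Rn n}

lemma measurable_affine (x₀ : Rn n) (r : ℝ) : Measurable fun x => x₀ + r • x :=
  measurable_const.add (measurable_const_smul r)

lemma map_affine_volume (hr : 0 < r) (x₀ : Rn n) :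
    Measure.map (fun x => x₀ + r • x) (volume : Measure (Rn n)) =
      ENNReal.ofReal (r ^ (-(n : ℝ))) • volume := by
  have h1 : (fun x : Rn n => x₀ + r • x) = (fun x => x₀ + x) ∘ fun x => r • x := rfl
  rw [h1, ← Measure.map_map (measurable_const_add x₀) (measurable_const_smul r),
    Measure.map_addHaar_smul _ hr.ne', Measure.map_smul, map_add_left_eq_self]
  congr 2
  rw [finrank_euclideanSpace, Fintype.card_fin, Real.rpow_neg hr.le, Real.rpow_natCast,
    abs_of_pos (by positivity)]

lemma lintegral_comp_affine (hr : 0 < r) (x₀ : Rn n) {f : Rn n → ℝ≥0∞} (hf : Measurable f) :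
    ∫⁻ x, f (x₀ + r • x) = ENNReal.ofReal (r ^ (-(n : ℝ))) * ∫⁻ x, f x := by
  rw [← lintegral_map hf (measurable_affine x₀ r), map_affine_volume hr, lintegral_smul_measure,
    smul_eq_mul]

lemma affine_mem_ball (hr : 0 < r) {R : ℝ} (x : Rn n) :
    x₀ + r • x ∈ ball x₀ (R * r) ↔ x ∈ ball 0 R := by
  rw [mem_ball, mem_ball, dist_eq_norm, dist_zero_right, add_sub_cancel_left, norm_smul,
    Real.norm_of_nonneg hr.le, mul_comm, mul_lt_mul_iff_left₀ hr]

lemma alignedEnergy_comp_affine (hr : 0 < r) (hd : 0 < d) (hu : Measurable u) (hφ : Measurable φ) :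
    alignedEnergy n s p (fun x => u (x₀ + r • x) / d) (fun x => φ (x₀ + r • x)) =
      ENNReal.ofReal (d ^ (-(p - 1)) * r ^ (s * p - n)) * alignedEnergy n s p u φ := by
  have hm := measurable_alignedDensity (s := s) (p := p) hu hφ
  have hpt : ∀ x y,
      alignedDensity n s p (fun x => u (x₀ + r • x) / d) (fun x => φ (x₀ + r • x)) x y =
      d ^ (-(p - 1)) * r ^ ((n : ℝ) + s * p) *
        alignedDensity n s p u φ (x₀ + r • x) (x₀ + r • y) := by
    intro x y
    have h1 : max (u (x₀ + r • x) / d - u (x₀ + r • y) / d) 0 =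
        max (u (x₀ + r • x) - u (x₀ + r • y)) 0 / d := by
      rw [← sub_div, ← max_div_div_right hd.le, zero_div]
    have h2 : ‖x₀ + r • x - (x₀ + r • y)‖ = r * ‖x - y‖ := by
      rw [add_sub_add_left_eq_sub, ← smul_sub, norm_smul, Real.norm_of_nonneg hr.le]
    have h3 : 0 < r ^ ((n : ℝ) + s * p) := by positivity
    simp only [alignedDensity]
    rw [h1, h2, Real.div_rpow (le_max_right _ _) hd.le, Real.mul_rpow hr.le (norm_nonneg _),
      Real.rpow_neg hd.le]
    field_simp
  have hmx : ∀ x, Measurable fun y => ENNReal.ofReal (alignedDensity n s p u φ x y) := fun x =>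
    (hm.comp measurable_prodMk_left).ennreal_ofReal
  have hmi : Measurable fun x => ∫⁻ y, ENNReal.ofReal (alignedDensity n s p u φ x y) :=
    hm.ennreal_ofReal.lintegral_prod_right'
  change ∫⁻ x, ∫⁻ y, ENNReal.ofReal (alignedDensity n s p (fun x => u (x₀ + r • x) / d)
    (fun x => φ (x₀ + r • x)) x y) = _ * ∫⁻ x, ∫⁻ y, ENNReal.ofReal (alignedDensity n s p u φ x y)
  simp only [hpt, ENNReal.ofReal_mul (by positivity : 0 ≤ d ^ (-(p - 1)) * r ^ ((n : ℝ) + s * p)),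
    lintegral_const_mul' _ _ ENNReal.ofReal_ne_top, lintegral_comp_affine hr x₀ (hmx _),
    lintegral_comp_affine hr x₀ hmi]
  rw [← mul_assoc, ← mul_assoc, ← ENNReal.ofReal_mul (by positivity),
    ← ENNReal.ofReal_mul (by positivity)]
  congr 2
  rw [mul_assoc, mul_assoc, ← Real.rpow_add hr, ← Real.rpow_add hr]
  congr 2
  ring

lemma lintegral_tail_comp_affine_le (hs : 0 < s) (hp : 1 < p) (hr : 0 < r) (hd : 0 < d)
    (hu : Measurable u)
    (h : tailFn n s p (fun x => max (-u x) 0) x₀ (4 * r) ≤ ENNReal.ofReal d) :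
    (∫⁻ y in (ball (0 : Rn n) 4)ᶜ, ENNReal.ofReal
      ((max (-(u (x₀ + r • y) / d)) 0) ^ (p - 1) / ‖y‖ ^ ((n : ℝ) + s * p))) ≤ 1 := by
  have hp1 : 0 < p - 1 := by linarith
  set J := ∫⁻ x in (ball x₀ (4 * r))ᶜ,
    ENNReal.ofReal (|max (-u x) 0| ^ (p - 1) / ‖x - x₀‖ ^ ((n : ℝ) + s * p)) with hJ
  have h1 : ENNReal.ofReal ((4 * r) ^ (s * p)) * J ≤ ENNReal.ofReal (d ^ (p - 1)) := by
    rw [tailFn, one_div, ENNReal.rpow_inv_le_iff hp1] at h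
    rwa [ENNReal.ofReal_rpow_of_pos hd] at h
  have h2 : (∫⁻ y in (ball (0 : Rn n) 4)ᶜ, ENNReal.ofReal
      ((max (-(u (x₀ + r • y) / d)) 0) ^ (p - 1) / ‖y‖ ^ ((n : ℝ) + s * p))) =
      ENNReal.ofReal (d ^ (-(p - 1)) * r ^ (s * p)) * J := by
    set G : Rn n → ℝ≥0∞ := (ball x₀ (4 * r))ᶜ.indicator fun x =>
      ENNReal.ofReal (|max (-u x) 0| ^ (p - 1) / ‖x - x₀‖ ^ ((n : ℝ) + s * p)) with hG
    have hGm : Measurable G := by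
      refine Measurable.indicator ?_ measurableSet_ball.compl
      fun_prop
    have hpt : ∀ y, (ball (0 : Rn n) 4)ᶜ.indicator (fun y => ENNReal.ofReal
        ((max (-(u (x₀ + r • y) / d)) 0) ^ (p - 1) / ‖y‖ ^ ((n : ℝ) + s * p))) y =
        ENNReal.ofReal (d ^ (-(p - 1)) * r ^ ((n : ℝ) + s * p)) * G (x₀ + r • y) := by
      intro y
      by_cases hy : y ∈ ball (0 : Rn n) 4
      · rw [indicator_of_notMem (by simpa using hy), hG, indicator_of_notMem, mul_zero]
        rw [mem_compl_iff, not_not, affine_mem_ball hr]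
        exact hy
      · rw [indicator_of_mem hy, hG, indicator_of_mem
          (by rw [mem_compl_iff, affine_mem_ball hr]; exact hy),
          ← ENNReal.ofReal_mul (by positivity)]
        congr 1
        have e1 : max (-(u (x₀ + r • y) / d)) 0 = max (-u (x₀ + r • y)) 0 / d := by
          rw [← neg_div, ← max_div_div_right hd.le, zero_div]
        have h3 : 0 < r ^ ((n : ℝ) + s * p) := by positivity
        rw [e1, Real.div_rpow (le_max_right _ _) hd.le, abs_of_nonneg (le_max_right _ _),
          add_sub_cancel_left, norm_smul, Real.norm_of_nonneg hr.le,
          Real.mul_rpow hr.le (norm_nonneg _), Real.rpow_neg hd.le]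
        field_simp
    rw [← lintegral_indicator measurableSet_ball.compl]
    simp only [hpt]
    rw [lintegral_const_mul' _ _ ENNReal.ofReal_ne_top, lintegral_comp_affine hr x₀ hGm, hG,
      lintegral_indicator measurableSet_ball.compl, ← mul_assoc,
      ← ENNReal.ofReal_mul (by positivity)]
    congr 2
    rw [mul_assoc, ← Real.rpow_add hr]
    congr 2
    ring
  rw [h2]
  calc ENNReal.ofReal (d ^ (-(p - 1)) * r ^ (s * p)) * J
      ≤ ENNReal.ofReal (d ^ (-(p - 1))) * (ENNReal.ofReal ((4 * r) ^ (s * p)) * J) := by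
        rw [← mul_assoc, ← ENNReal.ofReal_mul (by positivity)]
        gcongr
        linarith
    _ ≤ ENNReal.ofReal (d ^ (-(p - 1))) * ENNReal.ofReal (d ^ (p - 1)) := by gcongr
    _ = 1 := by
        rw [← ENNReal.ofReal_mul (by positivity), ← Real.rpow_add hd, neg_add_cancel,
          Real.rpow_zero,
          ENNReal.ofReal_one]

lemma volume_sublevel_comp_affine_ne_zero (hr : 0 < r) (hd : 0 < d) (hu : Measurable u)
    (h : essInf (fun x => ENNReal.ofReal (u x)) (volume.restrict (ball x₀ r)) < ENNReal.ofReal d) :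
    volume ({x | u (x₀ + r • x) / d < 1} ∩ ball (0 : Rn n) 1) ≠ 0 := by
  intro h0
  have hA : MeasurableSet ({x | u x < d} ∩ ball x₀ r) :=
    (measurableSet_lt hu measurable_const).inter measurableSet_ball
  have h1 : {x | u (x₀ + r • x) / d < 1} ∩ ball (0 : Rn n) 1 =
      (fun x => x₀ + r • x) ⁻¹' ({x | u x < d} ∩ ball x₀ r) := by
    ext x
    have := affine_mem_ball (x₀ := x₀) (R := 1) hr x
    rw [one_mul] at this
    simp only [mem_inter_iff, mem_ofPred_eq, mem_preimage, this, div_lt_one hd]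
  rw [h1, ← Measure.map_apply (measurable_affine x₀ r) hA, map_affine_volume hr, Measure.smul_apply,
    smul_eq_mul, mul_eq_zero] at h0
  have h2 : volume ({x | u x < d} ∩ ball x₀ r) = 0 :=
    h0.resolve_left (ENNReal.ofReal_pos.2 (Real.rpow_pos_of_pos hr _)).ne'
  refine h.not_ge (le_essInf_of_ae_le _ ?_)
  refine (ae_restrict_iff' measurableSet_ball).2 ?_
  filter_upwards [measure_eq_zero_iff_ae_notMem.1 h2] with x hx hxb
  refine ENNReal.ofReal_le_ofReal ?_
  by_contra hlt
  exact hx ⟨not_le.1 hlt, hxb⟩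

lemma unitSupersolution_comp_affine {Φ : ℝ → ℝ} {K : Rn n → Rn n → ℝ} {Ω : Set (Rn n)}
    {f : Rn n → ℝ}
    (hn : 1 ≤ n) (hs : 0 < s) (hs1 : s < 1) (hp : 1 < p) (hΛ : 1 ≤ Λ)
    (hK : KernelBounds n Λ s p K) (hΦ : PhiBounds Λ p Φ) (hu : Measurable u)
    (hug : gagliardo n s p univ u < ⊤) (hf : Continuous f) (hfc : HasCompactSupport f)
    (hf0 : ∀ x, 0 ≤ f x)
    (hw : ∀ ψ, IsTestFun n Ω ψ → nonlocalForm n Φ K u ψ = ∫ x, ψ x * f x)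
    (hr : 0 < r) (hΩ : ball x₀ (4 * r) ⊆ Ω) (hu0 : ∀ x ∈ ball x₀ (4 * r), 0 ≤ u x) (hd : 0 < d)
    (ht : tailFn n s p (fun x => max (-u x) 0) x₀ (4 * r) ≤ ENNReal.ofReal d) :
    UnitSupersolution n s p (Real.toNNReal (Λ ^ 4))
      (d ^ (-(p - 1)) * r ^ (s * p - n) * ((∫ x in ball x₀ r, f x) / 2))
      (fun x => u (x₀ + r • x) / d) where
  measurable := (hu.comp (measurable_affine x₀ r)).div_const d
  nonneg x hx := div_nonneg (hu0 _ ((affine_mem_ball hr x).2 hx)) hd.le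
  tail_le := lintegral_tail_comp_affine_le hs hp hr hd hu ht
  energy := by
    intro φ' hφ' m hm hmφ
    obtain ⟨N, hN⟩ := hφ'.bdd
    obtain ⟨L, hL, hlip⟩ := hφ'.lip
    obtain ⟨φ, hφ⟩ : ∃ φ : Rn n → ℝ, φ = fun x => φ' (r⁻¹ • (x - x₀)) := ⟨_, rfl⟩
    have hφm : Measurable φ := by
      rw [hφ]
      exact hφ'.measurable.comp ((measurable_id.sub_const x₀).const_smul r⁻¹)
    have hTinv : ∀ x, x₀ + r • (r⁻¹ • (x - x₀)) = x := fun x => by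
      rw [smul_inv_smul₀ hr.ne', add_sub_cancel]
    have hcomp : ∀ x, φ (x₀ + r • x) = φ' x := fun x => by
      rw [hφ]
      simp only [add_sub_cancel_left, inv_smul_smul₀ hr.ne']
    have hφ0 : ∀ x, 0 ≤ φ x := fun x => by rw [hφ]; exact hφ'.nonneg _
    have hφN : ∀ x, φ x ≤ N := fun x => by rw [hφ]; exact hN _
    have hz : ∀ x ∉ ball x₀ (3 * r), φ x = 0 := by
      intro x hx
      rw [hφ]
      refine hφ'.eq_zero _ fun hx' => hx ?_
      rw [← hTinv x]
      exact (affine_mem_ball hr _).2 hx'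
    have hlip' : ∀ x y, |φ x - φ y| ≤ L * (1 / d + 1 / r) * (|u x - u y| + ‖x - y‖) := by
      intro x y
      have h1 := hlip (r⁻¹ • (x - x₀)) (r⁻¹ • (y - x₀))
      have h2 : ‖r⁻¹ • (x - x₀) - r⁻¹ • (y - x₀)‖ = ‖x - y‖ / r := by
        rw [← smul_sub, sub_sub_sub_cancel_right, norm_smul, Real.norm_of_nonneg (by positivity),
          inv_mul_eq_div]
      rw [hTinv, hTinv, ← sub_div, abs_div, abs_of_pos hd, h2] at h1
      rw [hφ]
      refine h1.trans ?_
      rw [mul_assoc]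
      gcongr
      have h3 : 0 ≤ |u x - u y| / r := by positivity
      have h4 : 0 ≤ ‖x - y‖ / d := by positivity
      have h5 : (1 / d + 1 / r) * (|u x - u y| + ‖x - y‖) =
          |u x - u y| / d + ‖x - y‖ / r + |u x - u y| / r + ‖x - y‖ / d := by ring
      linarith
    have hφg := gagliardo_lt_top_of_abs_sub_le hn hs hs1 hp hu hug
      (by positivity : 0 ≤ L * (1 / d + 1 / r)) hlip' hφm hφ0 hφN hz
    have hE := energy_inequality hK hΦ hΛ hp hu hug hf hfc hf0 hw hφm hφ0 hφN hφg hz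
      (by linarith : 3 * r < 4 * r) hΩ
    have e1 := alignedEnergy_comp_affine (s := s) (p := p) (x₀ := x₀) hr hd hu hφm
    have e2 := alignedEnergy_comp_affine (s := s) (p := p) (x₀ := x₀) (φ := fun x => -φ x) hr hd hu
      hφm.neg
    simp only [hcomp] at e1 e2
    have hfi : Integrable f := hf.integrable_of_hasCompactSupport hfc
    have hmass : m * ∫ x in ball x₀ r, f x ≤ ∫ x, φ x * f x := by
      have hφf : Integrable fun x => φ x * f x :=
        hfi.bdd_mul (c := N) hφm.aestronglyMeasurable
          (ae_of_all _ fun x => by rw [Real.norm_of_nonneg (hφ0 x)]; exact hφN x)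
      rw [← integral_const_mul]
      refine (setIntegral_mono_on (hfi.const_mul m).integrableOn hφf.integrableOn measurableSet_ball
        fun x hx => ?_).trans (setIntegral_le_integral hφf
          (ae_of_all _ fun x => mul_nonneg (hφ0 x) (hf0 x)))
      refine mul_le_mul_of_nonneg_right ?_ (hf0 x)
      rw [← hTinv x, hcomp]
      refine hmφ _ ((affine_mem_ball (x₀ := x₀) hr _).1 ?_)
      rwa [hTinv, one_mul]
    have hκ : 0 ≤ d ^ (-(p - 1)) * r ^ (s * p - n) := by positivity
    have e3 : (Real.toNNReal (Λ ^ 4) : ℝ≥0∞) = ENNReal.ofReal (Λ ^ 4) := rfl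
    rw [e1, e2, e3, mul_left_comm (ENNReal.ofReal (Λ ^ 4))]
    refine le_trans ?_ (mul_le_mul_right hE _)
    rw [mul_add, ← ENNReal.ofReal_mul hκ]
    refine add_le_add (ENNReal.ofReal_le_ofReal ?_) le_rfl
    rw [mul_left_comm]
    refine mul_le_mul_of_nonneg_left ?_ hκ
    linarith

end Scaling

lemma measure_density_bound_of_measurable {n : ℕ} {s p Λ : ℝ} (hn : 1 ≤ n) (hs : 0 < s)
    (hs1 : s < 1) (hp : 1 < p) (hΛ : 1 ≤ Λ) :
    ∃ c : ℝ, 0 < c ∧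
      ∀ (Φ : ℝ → ℝ) (K : Rn n → Rn n → ℝ) (Ω : Set (Rn n)) (f u : Rn n → ℝ) (x₀ : Rn n) (r : ℝ),
        KernelBounds n Λ s p K → PhiBounds Λ p Φ → Continuous f → HasCompactSupport f →
        (∀ x, 0 ≤ f x) → Measurable u → gagliardo n s p univ u < ⊤ →
        (∀ ψ, IsTestFun n Ω ψ → nonlocalForm n Φ K u ψ = ∫ x, ψ x * f x) →
        0 < r → ball x₀ (4 * r) ⊆ Ω → (∀ x ∈ ball x₀ (4 * r), 0 ≤ u x) →
        ENNReal.ofReal ((∫ x in ball x₀ r, f x) / r ^ ((n : ℝ) - s * p)) ≤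
          ENNReal.ofReal c *
            (essInf (fun x => ENNReal.ofReal (u x)) (volume.restrict (ball x₀ r)) +
              tailFn n s p (fun x => max (-u x) 0) x₀ (4 * r)) ^ (p - 1) := by
  have hp1 : 0 < p - 1 := by linarith
  obtain ⟨C, hC⟩ := exists_mass_le (n := n) hn hs hs1 hp (Real.toNNReal (Λ ^ 4))
  refine ⟨2 * C + 1, by positivity, fun Φ K Ω f u x₀ r hK hΦ hf hfc hf0 hu hug hw hr hΩ hu0 => ?_⟩
  set I := essInf (fun x => ENNReal.ofReal (u x)) (volume.restrict (ball x₀ r))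
  set T := tailFn n s p (fun x => max (-u x) 0) x₀ (4 * r)
  rcases eq_or_ne (I + T) ⊤ with htop | htop
  · rw [htop, ENNReal.top_rpow_of_pos hp1, ENNReal.mul_top]
    · exact le_top
    · exact (ENNReal.ofReal_pos.2 (by positivity)).ne'
  have hbound : ∀ D : ℝ≥0∞, I + T < D → D < ⊤ →
      ENNReal.ofReal ((∫ x in ball x₀ r, f x) / r ^ ((n : ℝ) - s * p)) ≤
        ENNReal.ofReal (2 * C + 1) * D ^ (p - 1) := by
    intro D hD hDtop
    obtain ⟨d, rfl⟩ : ∃ d : ℝ, D = ENNReal.ofReal d :=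
      ⟨D.toReal, (ENNReal.ofReal_toReal hDtop.ne).symm⟩
    have hd : 0 < d := ENNReal.ofReal_pos.1 (pos_of_gt hD)
    have hM := hC _ _ (unitSupersolution_comp_affine hn hs hs1 hp hΛ hK hΦ hu hug hf hfc
      hf0 hw hr hΩ
      hu0 hd (le_add_self.trans hD.le)) (volume_sublevel_comp_affine_ne_zero hr hd hu
        (le_self_add.trans_lt hD))
    rw [ENNReal.ofReal_rpow_of_pos hd, ← ENNReal.ofReal_mul (by positivity)]
    refine ENNReal.ofReal_le_ofReal ?_
    rw [← ENNReal.ofReal_coe_nnreal, ENNReal.ofReal_le_ofReal_iff C.coe_nonneg] at hM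
    have hdp : 0 < d ^ (p - 1) := by positivity
    have h1 : (∫ x in ball x₀ r, f x) / r ^ ((n : ℝ) - s * p) = 2 * d ^ (p - 1) *
        (d ^ (-(p - 1)) * r ^ (s * p - n) * ((∫ x in ball x₀ r, f x) / 2)) := by
      rw [← neg_sub (n : ℝ) (s * p), Real.rpow_neg hr.le, Real.rpow_neg hd.le]
      field_simp
    rw [h1]
    calc _ ≤ 2 * d ^ (p - 1) * C := by gcongr
      _ ≤ _ := by linarith
  have hlim : Tendsto (fun D : ℝ≥0∞ => ENNReal.ofReal (2 * C + 1) * D ^ (p - 1)) (𝓝[>] (I + T))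
      (𝓝 (ENNReal.ofReal (2 * C + 1) * (I + T) ^ (p - 1))) :=
    (((ENNReal.continuous_const_mul ENNReal.ofReal_ne_top).comp
      ENNReal.continuous_rpow_const).tendsto _).mono_left nhdsWithin_le_nhds
  have : (𝓝[>] (I + T)).NeBot := nhdsGT_neBot_of_exists_gt ⟨⊤, htop.lt_top⟩
  refine ge_of_tendsto hlim ?_
  filter_upwards [self_mem_nhdsWithin, nhdsWithin_le_nhds (Iio_mem_nhds htop.lt_top)] with D h1 h2
  exact hbound D h1 h2

lemma gagliardo_congr_ae {n : ℕ} {s p : ℝ} {u v : Rn n → ℝ} (h : u =ᵐ[volume] v) :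
    gagliardo n s p univ u = gagliardo n s p univ v := by
  simp only [gagliardo, Measure.restrict_univ]
  refine lintegral_congr_ae ?_
  filter_upwards [h] with x hx
  refine lintegral_congr_ae ?_
  filter_upwards [h] with y hy
  rw [hx, hy]

lemma nonlocalForm_congr_ae {n : ℕ} {Φ : ℝ → ℝ} {K : Rn n → Rn n → ℝ} {u v : Rn n → ℝ}
    (h : u =ᵐ[volume] v) (φ : Rn n → ℝ) : nonlocalForm n Φ K u φ = nonlocalForm n Φ K v φ := by
  refine integral_congr_ae ?_
  filter_upwards [h] with x hx
  refine integral_congr_ae ?_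
  filter_upwards [h] with y hy
  rw [hx, hy]

lemma tailFn_congr_ae {n : ℕ} {s p : ℝ} {u v : Rn n → ℝ} (h : u =ᵐ[volume] v) (x₀ : Rn n) (r : ℝ) :
    tailFn n s p u x₀ r = tailFn n s p v x₀ r := by
  have : ∫⁻ x in (ball x₀ r)ᶜ, ENNReal.ofReal (|u x| ^ (p - 1) / ‖x - x₀‖ ^ ((n : ℝ) + s * p)) =
      ∫⁻ x in (ball x₀ r)ᶜ, ENNReal.ofReal (|v x| ^ (p - 1) / ‖x - x₀‖ ^ ((n : ℝ) + s * p)) := by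
    refine lintegral_congr_ae ?_
    filter_upwards [ae_restrict_of_ae h] with x hx
    rw [hx]
  rw [tailFn, tailFn, this]

/-- Lemma 7.4, measure density bound via infimum and Tail. -/
theorem measure_density_bound
    (n : ℕ) (s p Λ : ℝ)
    (hn : 2 ≤ n) (hs : 0 < s) (hs1 : s < 1) (hp : 2 - s / (n : ℝ) < p)
    (hpn : p < (n : ℝ) / s) (hΛ : 1 ≤ Λ) :
    ∃ c : ℝ, 0 < c ∧
      ∀ (Φ : ℝ → ℝ) (K : Rn n → Rn n → ℝ) (Ω : Set (Rn n)) (μ g u : Rn n → ℝ)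
        (x₀ : Rn n) (r : ℝ),
        KernelBounds n Λ s p K → PhiBounds Λ p Φ → IsOpen Ω →
        ContDiff ℝ (⊤ : ℕ∞) μ → HasCompactSupport μ → (∀ x, 0 ≤ μ x) →
        memWsp n s p univ g →
        WeakSol n Φ K s p Ω μ g u →
        0 < r → ball x₀ (4 * r) ⊆ Ω →
        (∀ᵐ x : Rn n, x ∈ ball x₀ (4 * r) → 0 ≤ u x) →
        ENNReal.ofReal ((∫ x in ball x₀ r, μ x) / r ^ ((n : ℝ) - s * p)) ≤
          ENNReal.ofReal c *
            (essInf (fun x => ENNReal.ofReal (u x)) (volume.restrict (ball x₀ r)) +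
              tailFn n s p (fun x => max (-u x) 0) x₀ (4 * r)) ^ (p - 1) := by

  classical
  have hn0 : (2 : ℝ) ≤ n := by exact_mod_cast hn
  have hp1 : 1 < p := by
    have : s / (n : ℝ) < 1 := by
      rw [div_lt_one (by linarith)]
      linarith
    linarith
  obtain ⟨c, hc, hbound⟩ := measure_density_bound_of_measurable (n := n) (by omega) hs hs1 hp1 hΛ
  refine ⟨c, hc, fun Φ K Ω μ g u x₀ r hK hΦ _ hμ hμc hμ0 _ hu hr hΩ hu0 => ?_⟩
  obtain ⟨⟨hum, -, hug⟩, -, hw⟩ := hu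
  rw [Measure.restrict_univ] at hum
  obtain ⟨v, hv, huv⟩ := hum
  obtain ⟨w, hwdef⟩ : ∃ w : Rn n → ℝ, w = (ball x₀ (4 * r)).piecewise (fun x => max (v x) 0) v :=
    ⟨_, rfl⟩
  have hwm : Measurable w := by
    rw [hwdef]
    exact Measurable.piecewise measurableSet_ball (hv.max measurable_const) hv
  have huw : u =ᵐ[volume] w := by
    filter_upwards [huv, hu0] with x hx hx0
    rw [hwdef]
    by_cases hxb : x ∈ ball x₀ (4 * r)
    · rw [piecewise_eq_of_mem _ _ _ hxb, ← hx, max_eq_left (hx0 hxb)]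
    · rw [piecewise_eq_of_notMem _ _ _ hxb, hx]
  have hw0 : ∀ x ∈ ball x₀ (4 * r), 0 ≤ w x := by
    intro x hx
    rw [hwdef, piecewise_eq_of_mem _ _ _ hx]
    exact le_max_right _ _
  have h := hbound Φ K Ω μ w x₀ r hK hΦ hμ.continuous hμc hμ0 hwm (gagliardo_congr_ae huw ▸ hug)
    (fun ψ hψ => nonlocalForm_congr_ae huw ψ ▸ hw ψ hψ) hr hΩ hw0
  have h1 : (fun x => ENNReal.ofReal (u x)) =ᵐ[volume.restrict (ball x₀ r)]
      fun x => ENNReal.ofReal (w x) := by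
    filter_upwards [ae_restrict_of_ae huw] with x hx
    rw [hx]
  have h2 : (fun x => max (-u x) 0) =ᵐ[volume] fun x => max (-w x) 0 := by
    filter_upwards [huw] with x hx
    rw [hx]
  rwa [essInf_congr_ae h1, tailFn_congr_ae h2]
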